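/- arXiv:1809.08595 — 6 statements merged into one kernel-verified Lean document; each statement's English description precedes it below -/
import Mathlib

section
/- There exist parameters p, q, r ∈ (0, 1/36) such that the system S_pqr = {S_1,...,S_6} of contracting similarities of ℝ satisfies all of the following: (1) S_pqr does not satisfy the open set condition; (2) for its attractor K, all intersections K_i ∩ K_j with i ≠ j are empty except for the single intersection K_3 ∩ K_4, which is the one-point set {h} where h = 8/15. -/
open Set

/-- The system `S_pqr = {S_1,…,S_6}` of similarities of `ℝ` (0-indexed: index `i : Fin 6`
corresponds to `S_{i+1}`), with `a = 1/5` and `h = 8/15`. -/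
noncomputable def Spqr (p q r : ℝ) : Fin 6 → ℝ → ℝ :=
  ![fun x => p * x,
    fun x => 1/5 + r * x,
    fun x => 8/15 - q * x,
    fun x => 8/15 - r + r * x,
    fun x => 1 - 1/5 - r * x,
    fun x => 1 - r + r * x]

/-- The open set condition for a system of six maps of `ℝ`. -/
def SatisfiesOSC (T : Fin 6 → ℝ → ℝ) : Prop :=
  ∃ O : Set ℝ, O.Nonempty ∧ IsOpen O ∧ (∀ i, T i '' O ⊆ O) ∧
    ∀ i j : Fin 6, i ≠ j → (T i '' O) ∩ (T j '' O) = ∅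

/-- `K` is the attractor of the system `T`: a nonempty compact set with `K = ⋃ i, T i (K)`. -/
def IsAttractor (T : Fin 6 → ℝ → ℝ) (K : Set ℝ) : Prop :=
  K.Nonempty ∧ IsCompact K ∧ K = ⋃ i, T i '' K

section

open MeasureTheory

/-- Each map of the system sends `[0,1]` into itself and contracts distances to `1/2`. -/
lemma Spqr_abs_sub_half_le {p q r : ℝ} (hp : p ∈ Ioc (0:ℝ) (1/1000))
    (hq : q ∈ Ioc (0:ℝ) (1/1000)) (hr : r ∈ Ioc (0:ℝ) (1/1000)) (i : Fin 6) (x : ℝ) :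
    ∃ c : ℝ, 0 ≤ c ∧ c ≤ 1/1000 ∧ |Spqr p q r i x - 1/2| ≤ 1/2 + c * (|x - 1/2| - 1/2) := by
  obtain ⟨hp0, hp1⟩ := hp
  obtain ⟨hq0, hq1⟩ := hq
  obtain ⟨hr0, hr1⟩ := hr
  have key : ∀ c : ℝ, 0 < c → c * (x - 1/2) ≤ c * |x - 1/2| ∧ -(c * |x - 1/2|) ≤ c * (x - 1/2) :=
    fun c hc => ⟨mul_le_mul_of_nonneg_left (le_abs_self _) hc.le, by
      have := mul_le_mul_of_nonneg_left (neg_abs_le (x - 1/2)) hc.le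
      linarith⟩
  have hp2 := key p hp0
  have hq2 := key q hq0
  have hr2 := key r hr0
  fin_cases i
  · exact ⟨p, hp0.le, hp1, abs_le.2 (by simp [Spqr]; constructor <;> linarith)⟩
  · exact ⟨r, hr0.le, hr1, abs_le.2 (by simp [Spqr]; constructor <;> linarith)⟩
  · exact ⟨q, hq0.le, hq1, abs_le.2 (by simp [Spqr]; constructor <;> linarith)⟩
  · exact ⟨r, hr0.le, hr1, abs_le.2 (by simp [Spqr]; constructor <;> linarith)⟩
  · exact ⟨r, hr0.le, hr1, abs_le.2 (by simp [Spqr]; constructor <;> linarith)⟩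
  · exact ⟨r, hr0.le, hr1, abs_le.2 (by simp [Spqr]; constructor <;> linarith)⟩

lemma IsAttractor.exists_eq {T : Fin 6 → ℝ → ℝ} {K : Set ℝ} (hK : IsAttractor T K) {x : ℝ}
    (hx : x ∈ K) : ∃ i, ∃ y ∈ K, T i y = x := by
  rw [hK.2.2] at hx
  simpa using hx

lemma IsAttractor.apply_mem {T : Fin 6 → ℝ → ℝ} {K : Set ℝ} (hK : IsAttractor T K) {x : ℝ}
    (hx : x ∈ K) (i : Fin 6) : T i x ∈ K := by
  rw [hK.2.2]
  exact mem_iUnion.2 ⟨i, x, hx, rfl⟩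

lemma IsAttractor.subset_Icc {p q r : ℝ} (hp : p ∈ Ioc (0:ℝ) (1/1000))
    (hq : q ∈ Ioc (0:ℝ) (1/1000)) (hr : r ∈ Ioc (0:ℝ) (1/1000)) {K : Set ℝ}
    (hK : IsAttractor (Spqr p q r) K) : K ⊆ Icc 0 1 := by
  obtain ⟨z, hz, hmax⟩ := hK.2.1.exists_isMaxOn hK.1
    (f := fun x : ℝ => |x - 1/2|) (by fun_prop)
  have hz2 : |z - 1/2| ≤ 1/2 := by
    obtain ⟨i, y, hy, hyz⟩ := hK.exists_eq hz
    obtain ⟨c, hc0, hc1, hc⟩ := Spqr_abs_sub_half_le hp hq hr i y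
    rw [hyz] at hc
    have hyz2 : |y - 1/2| ≤ |z - 1/2| := hmax hy
    nlinarith
  intro x hx
  have hxz : |x - 1/2| ≤ |z - 1/2| := hmax hx
  have := abs_le.1 (hxz.trans hz2)
  constructor <;> linarith

/-- The image of `[0,1]` under the composition of the maps of `T` along the word `w`. -/
def wordCylinder (T : Fin 6 → ℝ → ℝ) : (k : ℕ) → (Fin k → Fin 6) → Set ℝ
  | 0, _ => Icc 0 1
  | k + 1, w => T (w 0) '' wordCylinder T k (Fin.tail w)

lemma wordCylinder_subset_Icc {p q r : ℝ} (hp : p ∈ Ioc (0:ℝ) (1/1000))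
    (hq : q ∈ Ioc (0:ℝ) (1/1000)) (hr : r ∈ Ioc (0:ℝ) (1/1000)) (k : ℕ) (w : Fin k → Fin 6) :
    wordCylinder (Spqr p q r) k w ⊆ Icc 0 1 := by
  induction k with
  | zero => exact subset_rfl
  | succ k ih =>
    rintro _ ⟨x, hx, rfl⟩
    have hx2 := ih _ hx
    have hx3 : |x - 1/2| ≤ 1/2 := abs_le.2 ⟨by linarith [hx2.1], by linarith [hx2.2]⟩
    obtain ⟨c, hc0, hc1, hc⟩ := Spqr_abs_sub_half_le hp hq hr (w 0) x
    have := abs_le.1 (hc.trans (b := 1/2 + c * (|x - 1/2| - 1/2)) (c := 1/2) (by nlinarith))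
    constructor <;> linarith

lemma IsAttractor.exists_mem_wordCylinder {p q r : ℝ} (hp : p ∈ Ioc (0:ℝ) (1/1000))
    (hq : q ∈ Ioc (0:ℝ) (1/1000)) (hr : r ∈ Ioc (0:ℝ) (1/1000)) {K : Set ℝ}
    (hK : IsAttractor (Spqr p q r) K) (k : ℕ) {x : ℝ} (hx : x ∈ K) :
    ∃ w, x ∈ wordCylinder (Spqr p q r) k w := by
  induction k generalizing x with
  | zero => exact ⟨Fin.elim0, hK.subset_Icc hp hq hr hx⟩
  | succ k ih =>
    obtain ⟨i, y, hy, rfl⟩ := hK.exists_eq hx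
    obtain ⟨w, hw⟩ := ih hy
    exact ⟨Fin.cons i w, y, by simpa using hw, by simp⟩

lemma abs_Spqr_sub_le {p q₁ q₂ r : ℝ} (hp : p ∈ Ioc (0:ℝ) (1/1000))
    (hq₂ : q₂ ∈ Ioc (0:ℝ) (1/1000)) (hr : r ∈ Ioc (0:ℝ) (1/1000)) (i : Fin 6) {x₁ : ℝ}
    (hx₁ : x₁ ∈ Icc (0:ℝ) 1) (x₂ : ℝ) :
    |Spqr p q₁ r i x₁ - Spqr p q₂ r i x₂| ≤ |q₁ - q₂| + 1/1000 * |x₁ - x₂| := by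
  have key : ∀ c ∈ Ioc (0:ℝ) (1/1000), |c * (x₁ - x₂)| ≤ 1/1000 * |x₁ - x₂| := fun c hc => by
    rw [abs_mul, abs_of_pos hc.1]
    exact mul_le_mul_of_nonneg_right hc.2 (abs_nonneg _)
  have hpr : ∀ c ∈ Ioc (0:ℝ) (1/1000), |c * (x₁ - x₂)| ≤ |q₁ - q₂| + 1/1000 * |x₁ - x₂| :=
    fun c hc => (key c hc).trans (le_add_of_nonneg_left (abs_nonneg _))
  fin_cases i
  · convert hpr p hp using 2; simp [Spqr]; ring
  · convert hpr r hr using 2; simp [Spqr]; ring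
  · have h1 : |(q₁ - q₂) * x₁| ≤ |q₁ - q₂| := by
      rw [abs_mul, abs_of_nonneg hx₁.1]
      exact mul_le_of_le_one_right (abs_nonneg _) hx₁.2
    have h2 : (8/15 - q₁ * x₁) - (8/15 - q₂ * x₂) = -((q₁ - q₂) * x₁ + q₂ * (x₁ - x₂)) := by ring
    change |(8/15 - q₁ * x₁) - (8/15 - q₂ * x₂)| ≤ _
    rw [h2, abs_neg]
    exact (abs_add_le _ _).trans (add_le_add h1 (key q₂ hq₂))
  · convert hpr r hr using 2; simp [Spqr]; ring
  · rw [abs_sub_comm]; convert hpr r hr using 2; simp [Spqr]; ring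
  · convert hpr r hr using 2; simp [Spqr]; ring

lemma abs_sub_le_of_mem_wordCylinder {p q₁ q₂ r : ℝ} (hp : p ∈ Ioc (0:ℝ) (1/1000))
    (hq₁ : q₁ ∈ Ioc (0:ℝ) (1/1000)) (hq₂ : q₂ ∈ Ioc (0:ℝ) (1/1000))
    (hr : r ∈ Ioc (0:ℝ) (1/1000)) (k : ℕ) (w : Fin k → Fin 6) {x₁ x₂ : ℝ}
    (h₁ : x₁ ∈ wordCylinder (Spqr p q₁ r) k w) (h₂ : x₂ ∈ wordCylinder (Spqr p q₂ r) k w) :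
    |x₁ - x₂| ≤ 2 * |q₁ - q₂| + (1/1000) ^ k := by
  induction k generalizing x₁ x₂ with
  | zero =>
    have : |x₁ - x₂| ≤ 1 := abs_le.2 ⟨by linarith [h₁.1, h₂.2], by linarith [h₁.2, h₂.1]⟩
    simpa using this.trans (le_add_of_nonneg_left (by positivity))
  | succ k ih =>
    obtain ⟨y₁, hy₁, rfl⟩ := h₁
    obtain ⟨y₂, hy₂, rfl⟩ := h₂
    have h1 := abs_Spqr_sub_le (q₁ := q₁) hp hq₂ hr (w 0) (wordCylinder_subset_Icc hp hq₁ hr _ _ hy₁) y₂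
    have h2 := ih _ hy₁ hy₂
    have h3 := abs_nonneg (q₁ - q₂)
    rw [pow_succ]
    linarith

/-- Parameters `q` for which some attractor of `Spqr p q r` has points away from `0` and `1`
related by `q * x = c * (1 - y)`. -/
def exceptionalSet (p r c : ℝ) : Set ℝ :=
  {q | q ∈ Ioc (0:ℝ) (1/1000) ∧ ∃ K, IsAttractor (Spqr p q r) K ∧ ∃ x ∈ K, ∃ y ∈ K,
    1/5 ≤ x ∧ y ≤ 4/5 ∧ q * x = c * (1 - y)}

/-- A transversality estimate. -/
lemma abs_sub_le_of_mul_eq {c ε q₁ q₂ x₁ x₂ y₁ y₂ : ℝ}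
    (hq₁ : q₁ ∈ Ioc (0:ℝ) (1/1000)) (hx₂ : x₂ ∈ Icc (1/5:ℝ) 1)
    (hy₁ : y₁ ∈ Icc (0:ℝ) (4/5)) (hy₂ : y₂ ∈ Icc (0:ℝ) (4/5))
    (h₁ : q₁ * x₁ = c * (1 - y₁)) (h₂ : q₂ * x₂ = c * (1 - y₂))
    (hx : |x₁ - x₂| ≤ 2 * |q₁ - q₂| + ε) (hy : |y₁ - y₂| ≤ 2 * |q₁ - q₂| + ε) :
    |q₁ - q₂| ≤ ε := by
  have h3 : (q₁ - q₂) * (x₂ * (1 - y₁)) =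
      -(q₁ * ((x₁ - x₂) * (1 - y₂) + x₂ * (y₁ - y₂))) := by
    linear_combination (1 - y₂) * h₁ - (1 - y₁) * h₂
  have h4 : 1/25 ≤ x₂ * (1 - y₁) := by nlinarith [hx₂.1, hy₁.2]
  have h5 : |q₁ - q₂| * (x₂ * (1 - y₁)) ≤ 1/1000 * (|x₁ - x₂| + |y₁ - y₂|) := by
    calc |q₁ - q₂| * (x₂ * (1 - y₁)) = |(q₁ - q₂) * (x₂ * (1 - y₁))| := by
          rw [abs_mul, abs_of_pos (a := x₂ * _) (by linarith)]
      _ = q₁ * |(x₁ - x₂) * (1 - y₂) + x₂ * (y₁ - y₂)| := by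
          rw [h3, abs_neg, abs_mul, abs_of_pos hq₁.1]
      _ ≤ 1/1000 * (|x₁ - x₂| + |y₁ - y₂|) := by
          refine mul_le_mul hq₁.2 ((abs_add_le _ _).trans (add_le_add ?_ ?_)) (abs_nonneg _)
            (by norm_num)
          · rw [abs_mul, abs_of_nonneg (a := 1 - y₂) (by linarith [hy₂.2])]
            exact mul_le_of_le_one_right (abs_nonneg _) (by linarith [hy₂.1])
          · rw [abs_mul, abs_of_nonneg (a := x₂) (by linarith [hx₂.1])]
            exact mul_le_of_le_one_left (abs_nonneg _) hx₂.2
  have h6 := mul_le_mul_of_nonneg_left h4 (abs_nonneg (q₁ - q₂))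
  linarith [abs_nonneg (q₁ - q₂)]

lemma volume_exceptionalSet {p r : ℝ} (hp : p ∈ Ioc (0:ℝ) (1/1000))
    (hr : r ∈ Ioc (0:ℝ) (1/1000)) (c : ℝ) : volume (exceptionalSet p r c) = 0 := by
  have bound : ∀ k : ℕ, volume (exceptionalSet p r c) ≤ ENNReal.ofReal ((36/1000) ^ k) := by
    intro k
    let s : (Fin k → Fin 6) × (Fin k → Fin 6) → Set ℝ := fun w =>
      {q | q ∈ Ioc (0:ℝ) (1/1000) ∧ ∃ x ∈ wordCylinder (Spqr p q r) k w.1,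
        ∃ y ∈ wordCylinder (Spqr p q r) k w.2, 1/5 ≤ x ∧ y ≤ 4/5 ∧ q * x = c * (1 - y)}
    have hs : ∀ w, volume (s w) ≤ ENNReal.ofReal ((1/1000) ^ k) := by
      intro w
      refine (Real.volume_le_diam _).trans (Metric.ediam_le ?_)
      rintro q₁ ⟨hq₁, x₁, hx₁, y₁, hy₁, hx₁', hy₁', h₁⟩ q₂ ⟨hq₂, x₂, hx₂, y₂, hy₂, hx₂', hy₂', h₂⟩
      rw [edist_dist, Real.dist_eq]
      refine ENNReal.ofReal_le_ofReal (abs_sub_le_of_mul_eq hq₁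
        ⟨hx₂', (wordCylinder_subset_Icc hp hq₂ hr _ _ hx₂).2⟩
        ⟨(wordCylinder_subset_Icc hp hq₁ hr _ _ hy₁).1, hy₁'⟩
        ⟨(wordCylinder_subset_Icc hp hq₂ hr _ _ hy₂).1, hy₂'⟩ h₁ h₂
        (abs_sub_le_of_mem_wordCylinder hp hq₁ hq₂ hr _ _ hx₁ hx₂)
        (abs_sub_le_of_mem_wordCylinder hp hq₁ hq₂ hr _ _ hy₁ hy₂))
    have hsub : exceptionalSet p r c ⊆ ⋃ w, s w := by
      rintro q ⟨hq, K, hK, x, hx, y, hy, hx', hy', h⟩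
      obtain ⟨v, hv⟩ := hK.exists_mem_wordCylinder hp hq hr k hx
      obtain ⟨w, hw⟩ := hK.exists_mem_wordCylinder hp hq hr k hy
      exact mem_iUnion.2 ⟨(v, w), hq, x, hv, y, hw, hx', hy', h⟩
    calc volume (exceptionalSet p r c) ≤ volume (⋃ w, s w) := measure_mono hsub
      _ ≤ ∑ w, volume (s w) := measure_iUnion_fintype_le _ _
      _ ≤ ∑ _w : (Fin k → Fin 6) × (Fin k → Fin 6), ENNReal.ofReal ((1/1000) ^ k) :=
          Finset.sum_le_sum fun w _ => hs w
      _ = ENNReal.ofReal ((36/1000) ^ k) := by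
          rw [Finset.sum_const, ← ENNReal.ofReal_nsmul]
          congr 1
          simp only [Finset.card_univ, Fintype.card_prod, Fintype.card_fun, Fintype.card_fin,
            nsmul_eq_mul]
          push_cast
          rw [← mul_pow, ← mul_pow]
          norm_num
  have lim : Filter.Tendsto (fun k : ℕ => ENNReal.ofReal ((36/1000 : ℝ) ^ k)) Filter.atTop
      (nhds 0) := by
    have := ENNReal.tendsto_ofReal
      (tendsto_pow_atTop_nhds_zero_of_lt_one (r := (36/1000 : ℝ)) (by norm_num) (by norm_num))
    simpa using this
  exact le_antisymm (ge_of_tendsto' lim bound) bot_le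

lemma exists_notMem_exceptionalSet {p r : ℝ} (hp : p ∈ Ioc (0:ℝ) (1/1000))
    (hr : r ∈ Ioc (0:ℝ) (1/1000)) : ∃ q ∈ Ioc (0:ℝ) (1/1000), ∀ m n : ℕ,
      q ∉ exceptionalSet p r (r ^ (n + 1) / p ^ m) := by
  by_contra! hcon
  have hnull : volume (⋃ m : ℕ, ⋃ n : ℕ, exceptionalSet p r (r ^ (n + 1) / p ^ m)) = 0 :=
    measure_iUnion_null fun m => measure_iUnion_null fun n => volume_exceptionalSet hp hr _
  have hle := measure_mono_null (s := Ioc (0:ℝ) (1/1000)) (fun q hq => by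
    obtain ⟨m, n, h⟩ := hcon q hq
    exact mem_iUnion.2 ⟨m, mem_iUnion.2 ⟨n, h⟩⟩) hnull
  rw [Real.volume_Ioc] at hle
  norm_num at hle

end

lemma exists_nat_abs_add_mul_sub_lt {A B : ℝ} (hA : 0 < A) (hB : 0 < B)
    (hAB : Irrational (A / B)) (c : ℝ) {ε : ℝ} (hε : 0 < ε) :
    ∃ m n : ℕ, |c + m * A - (n + 1) * B| < ε := by
  obtain ⟨N, hN⟩ := exists_nat_gt (B / ε)
  have hN0 : 0 < N := by
    have : (0:ℝ) < N := lt_trans (by positivity) hN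
    exact_mod_cast this
  obtain ⟨k, hk0, -, hk⟩ := Real.exists_nat_abs_mul_sub_round_le (A / B) hN0
  have hj : 0 ≤ round (k * (A / B)) := by
    rw [round_eq]
    exact Int.floor_nonneg.2 (by positivity)
  obtain ⟨j, hj⟩ := Int.eq_ofNat_of_zero_le hj
  rw [hj] at hk
  have he : (k * (A / B) - j) * B = k * A - j * B := by field_simp
  set e := k * A - j * B with hedef
  have he0 : e ≠ 0 := by
    intro h0
    have h1 : k * (A / B) - j = 0 := by
      rw [h0] at he
      exact (mul_eq_zero.1 he).resolve_right hB.ne'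
    exact (hAB.natCast_mul hk0.ne').ne_nat j (by linarith)
  have heε : |e| < ε := by
    rw [← he, abs_mul, abs_of_pos hB]
    have h1 : 1 / ((N:ℝ) + 1) * B < ε := by
      rw [div_lt_iff₀ hε] at hN
      rw [one_div, inv_mul_lt_iff₀ (by positivity)]
      linarith
    refine lt_of_le_of_lt (mul_le_mul_of_nonneg_right ?_ hB.le) h1
    exact_mod_cast hk
  have step : ∀ x : ℝ, 0 ≤ x → ∃ t : ℕ, |x - t * (|e|)| < ε := by
    intro x hx
    have he1 : 0 < |e| := abs_pos.2 he0
    refine ⟨⌊x / |e|⌋₊, ?_⟩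
    have h1 := Nat.floor_le (div_nonneg hx he1.le)
    have h2 := Nat.lt_floor_add_one (x / |e|)
    rw [le_div_iff₀ he1] at h1
    rw [div_lt_iff₀ he1] at h2
    rw [abs_of_nonneg (by linarith)]
    linarith
  rcases lt_or_gt_of_ne he0 with hneg | hpos
  · obtain ⟨M, hM⟩ := exists_nat_ge ((B - c) / A)
    rw [div_le_iff₀ hA] at hM
    obtain ⟨t, ht⟩ := step (c + M * A - B) (by linarith)
    refine ⟨M + t * k, t * j, ?_⟩
    rw [abs_of_neg hneg] at ht
    convert ht using 2
    push_cast
    rw [hedef]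
    ring
  · obtain ⟨M, hM⟩ := exists_nat_ge (c / B)
    rw [div_le_iff₀ hB] at hM
    obtain ⟨t, ht⟩ := step ((M + 1) * B - c) (by linarith)
    refine ⟨t * k, M + t * j, ?_⟩
    rw [abs_of_pos hpos] at ht
    rw [abs_sub_comm] at ht
    convert ht using 2
    push_cast
    rw [hedef]
    ring

lemma exists_nat_abs_mul_pow_div_sub_one_lt {p q r : ℝ} (hp : p ∈ Ioo (0:ℝ) 1) (hq : 0 < q)
    (hr : r ∈ Ioo (0:ℝ) 1) (hpr : Irrational (Real.log p / Real.log r)) {δ : ℝ} (hδ : 0 < δ) :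
    ∃ m n : ℕ, |q * p ^ m / r ^ (n + 1) - 1| < δ := by
  obtain ⟨ε, hε, h⟩ := Metric.continuousAt_iff.1 (Real.continuous_exp.continuousAt (x := 0)) δ hδ
  obtain ⟨m, n, hmn⟩ := exists_nat_abs_add_mul_sub_lt (A := -Real.log p) (B := -Real.log r)
    (neg_pos.2 (Real.log_neg hp.1 hp.2)) (neg_pos.2 (Real.log_neg hr.1 hr.2))
    (by rwa [neg_div_neg_eq]) (-Real.log q) hε
  refine ⟨m, n, ?_⟩
  have h1 := h (x := -(-Real.log q + m * -Real.log p - (n + 1) * -Real.log r))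
    (by rwa [Real.dist_eq, sub_zero, abs_neg])
  have hp0 := hp.1
  have hr0 := hr.1
  have h2 : Real.log (q * p ^ m / r ^ (n + 1)) =
      -(-Real.log q + m * -Real.log p - (n + 1) * -Real.log r) := by
    rw [Real.log_div (by positivity) (by positivity), Real.log_mul (by positivity) (by positivity),
      Real.log_pow, Real.log_pow]
    push_cast
    ring
  rwa [← h2, Real.exp_log (by positivity), Real.exp_zero, Real.dist_eq] at h1

lemma not_satisfiesOSC_Spqr {p q r : ℝ} (hp : p ∈ Ioo (0:ℝ) 1) (hq : 0 < q)
    (hr : r ∈ Ioo (0:ℝ) 1) (hpr : Irrational (Real.log p / Real.log r)) :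
    ¬ SatisfiesOSC (Spqr p q r) := by
  rintro ⟨O, ⟨x, hx⟩, hO, hmaps, hdisj⟩
  have hmem : ∀ i, ∀ y ∈ O, Spqr p q r i y ∈ O := fun i y hy => hmaps i ⟨y, hy, rfl⟩
  have h0 : ∀ m : ℕ, ∀ y ∈ O, p ^ m * y ∈ O := by
    intro m
    induction m with
    | zero => simp
    | succ m ih =>
      intro y hy
      have := hmem 0 _ (ih y hy)
      rw [pow_succ']
      simpa [Spqr, mul_assoc] using this
  have h5 : ∀ n : ℕ, ∀ y ∈ O, 1 - r ^ n * (1 - y) ∈ O := by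
    intro n
    induction n with
    | zero => simp
    | succ n ih =>
      intro y hy
      have := hmem 5 _ (ih y hy)
      have e : 1 - r ^ (n + 1) * (1 - y) = 1 - r + r * (1 - r ^ n * (1 - y)) := by ring
      rw [e]
      simpa [Spqr] using this
  have hr0 := hr.1
  have hcont : ContinuousAt (fun l : ℝ => x * l + (l - 1) / (5 * r)) 1 := by fun_prop
  have hnear := hcont.preimage_mem_nhds (t := O) (hO.mem_nhds (by simpa using hx))
  obtain ⟨δ, hδ, hball⟩ := Metric.mem_nhds_iff.1 hnear
  obtain ⟨m, n, hmn⟩ := exists_nat_abs_mul_pow_div_sub_one_lt hp hq hr hpr hδ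
  set l := q * p ^ m / r ^ (n + 1) with hl
  have hy : x * l + (l - 1) / (5 * r) ∈ O := hball (by rwa [Metric.mem_ball, Real.dist_eq])
  have hlr : q * p ^ m = l * r ^ (n + 1) := by rw [hl]; field_simp
  have hu := h0 m _ (hmem 1 _ hx)
  have hv := h5 n _ (hmem 4 _ hy)
  refine (hdisj 2 3 (by decide)).subset ⟨⟨_, hu, rfl⟩, _, hv, ?_⟩
  change 8/15 - r + r * (1 - r ^ n * (1 - (1 - 1/5 - r * (x * l + (l - 1) / (5 * r))))) =
    8/15 - q * (p ^ m * (1/5 + r * x))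
  have e1 : r * ((l - 1) / (5 * r)) = (l - 1) / 5 := by field_simp
  linear_combination (-r ^ (n + 1)) * e1 + (1/5 + r * x) * hlr

lemma IsAttractor.zero_mem {p q r : ℝ} (hp : p ∈ Ioo (0:ℝ) 1) {K : Set ℝ}
    (hK : IsAttractor (Spqr p q r) K) : (0:ℝ) ∈ K := by
  obtain ⟨x, hx⟩ := hK.1
  have h : ∀ m : ℕ, p ^ m * x ∈ K := by
    intro m
    induction m with
    | zero => simpa
    | succ m ih =>
      have := hK.apply_mem ih 0
      rw [pow_succ']
      simpa [Spqr, mul_assoc] using this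
  have lim := (tendsto_pow_atTop_nhds_zero_of_lt_one hp.1.le hp.2).mul_const x
  rw [zero_mul] at lim
  exact hK.2.1.isClosed.mem_of_tendsto lim (Filter.Eventually.of_forall h)

lemma IsAttractor.one_mem {p q r : ℝ} (hr : r ∈ Ioo (0:ℝ) 1) {K : Set ℝ}
    (hK : IsAttractor (Spqr p q r) K) : (1:ℝ) ∈ K := by
  obtain ⟨x, hx⟩ := hK.1
  have h : ∀ m : ℕ, 1 - r ^ m * (1 - x) ∈ K := by
    intro m
    induction m with
    | zero => simpa
    | succ m ih =>
      have := hK.apply_mem ih 5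
      have e : 1 - r ^ (m + 1) * (1 - x) = 1 - r + r * (1 - r ^ m * (1 - x)) := by ring
      rw [e]
      simpa [Spqr] using this
  have lim := ((tendsto_pow_atTop_nhds_zero_of_lt_one hr.1.le hr.2).mul_const (1 - x)).const_sub 1
  rw [zero_mul, sub_zero] at lim
  exact hK.2.1.isClosed.mem_of_tendsto lim (Filter.Eventually.of_forall h)

/-- A piece of the attractor lies in the image of `[0,1]`. -/
lemma Spqr_mem_Icc {p q r x : ℝ} (hp : p ∈ Ioc (0:ℝ) (1/1000)) (hq : q ∈ Ioc (0:ℝ) (1/1000))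
    (hr : r ∈ Ioc (0:ℝ) (1/1000)) (hx : x ∈ Icc (0:ℝ) 1) (i : Fin 6) :
    Spqr p q r i x ∈ Icc ((![0, 1/5, 8/15 - 1/1000, 8/15 - 1/1000, 4/5 - 1/1000, 999/1000] :
        Fin 6 → ℝ) i)
      ((![1/1000, 1/5 + 1/1000, 8/15, 8/15, 4/5, 1] : Fin 6 → ℝ) i) := by
  obtain ⟨hp0, hp1⟩ := hp
  obtain ⟨hq0, hq1⟩ := hq
  obtain ⟨hr0, hr1⟩ := hr
  have key : ∀ c : ℝ, 0 < c → 0 ≤ c * x ∧ c * x ≤ c := fun c hc =>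
    ⟨mul_nonneg hc.le hx.1, mul_le_of_le_one_right hc.le hx.2⟩
  have hp2 := key p hp0
  have hq2 := key q hq0
  have hr2 := key r hr0
  fin_cases i <;> simp [Spqr] <;> constructor <;> linarith

lemma IsAttractor.exists_eq_pow_mul {p q r : ℝ} (hp : p ∈ Ioc (0:ℝ) (1/1000))
    (hq : q ∈ Ioc (0:ℝ) (1/1000)) (hr : r ∈ Ioc (0:ℝ) (1/1000)) {K : Set ℝ}
    (hK : IsAttractor (Spqr p q r) K) {x : ℝ} (hx : x ∈ K) (hx0 : x ≠ 0) :
    ∃ m : ℕ, ∃ y ∈ K, 1/5 ≤ y ∧ x = p ^ m * y := by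
  by_contra! hcon
  have h : ∀ m : ℕ, ∃ y ∈ K, x = p ^ m * y := by
    intro m
    induction m with
    | zero => exact ⟨x, hx, by simp⟩
    | succ m ih =>
      obtain ⟨y, hy, hxy⟩ := ih
      obtain ⟨i, z, hz, rfl⟩ := hK.exists_eq hy
      have hi : i = 0 := by
        by_contra hi
        refine hcon m _ hy ?_ hxy
        have h1 := (Spqr_mem_Icc hp hq hr (hK.subset_Icc hp hq hr hz) i).1
        refine le_trans ?_ h1
        revert hi
        fin_cases i <;> norm_num
      subst hi
      exact ⟨z, hz, by rw [hxy, pow_succ, mul_assoc]; rfl⟩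
  have hx1 := hK.subset_Icc hp hq hr hx
  refine hx0 (le_antisymm (ge_of_tendsto' (tendsto_pow_atTop_nhds_zero_of_lt_one hp.1.le
    (hp.2.trans_lt (by norm_num))) fun m => ?_) hx1.1)
  obtain ⟨y, hy, rfl⟩ := h m
  exact mul_le_of_le_one_right (pow_nonneg hp.1.le m) (hK.subset_Icc hp hq hr hy).2

lemma IsAttractor.exists_eq_one_sub_pow_mul {p q r : ℝ} (hp : p ∈ Ioc (0:ℝ) (1/1000))
    (hq : q ∈ Ioc (0:ℝ) (1/1000)) (hr : r ∈ Ioc (0:ℝ) (1/1000)) {K : Set ℝ}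
    (hK : IsAttractor (Spqr p q r) K) {x : ℝ} (hx : x ∈ K) (hx0 : x ≠ 1) :
    ∃ m : ℕ, ∃ y ∈ K, y ≤ 4/5 ∧ 1 - x = r ^ m * (1 - y) := by
  by_contra! hcon
  have h : ∀ m : ℕ, ∃ y ∈ K, 1 - x = r ^ m * (1 - y) := by
    intro m
    induction m with
    | zero => exact ⟨x, hx, by simp⟩
    | succ m ih =>
      obtain ⟨y, hy, hxy⟩ := ih
      obtain ⟨i, z, hz, rfl⟩ := hK.exists_eq hy
      have hi : i = 5 := by
        by_contra hi
        refine hcon m _ hy ?_ hxy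
        have h1 := (Spqr_mem_Icc hp hq hr (hK.subset_Icc hp hq hr hz) i).2
        refine h1.trans ?_
        revert hi
        fin_cases i <;> first | (norm_num; done) | simp
      subst hi
      refine ⟨z, hz, ?_⟩
      have e : Spqr p q r 5 z = 1 - r + r * z := rfl
      rw [hxy, e]
      ring
  have hx1 := hK.subset_Icc hp hq hr hx
  have hle : 1 - x ≤ 0 := ge_of_tendsto' (tendsto_pow_atTop_nhds_zero_of_lt_one hr.1.le
    (hr.2.trans_lt (by norm_num))) fun m => by
      obtain ⟨y, hy, hxy⟩ := h m
      rw [hxy]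
      exact mul_le_of_le_one_right (pow_nonneg hr.1.le m)
        (by linarith [(hK.subset_Icc hp hq hr hy).1])
  exact hx0 (le_antisymm hx1.2 (by linarith))

lemma IsAttractor.inter_eq_singleton {p q r : ℝ} (hp : p ∈ Ioc (0:ℝ) (1/1000))
    (hq : q ∈ Ioc (0:ℝ) (1/1000)) (hr : r ∈ Ioc (0:ℝ) (1/1000))
    (hgen : ∀ m n : ℕ, q ∉ exceptionalSet p r (r ^ (n + 1) / p ^ m)) {K : Set ℝ}
    (hK : IsAttractor (Spqr p q r) K) :
    (Spqr p q r 2 '' K) ∩ (Spqr p q r 3 '' K) = {8/15} := by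
  apply Subset.antisymm
  · rintro _ ⟨⟨x, hx, rfl⟩, y, hy, hxy⟩
    replace hxy : 8/15 - r + r * y = 8/15 - q * x := hxy
    change 8/15 - q * x = 8/15
    rcases eq_or_ne x 0 with rfl | hx0
    · simp
    exfalso
    have hy1 : y ≠ 1 := by
      rintro rfl
      exact mul_ne_zero hq.1.ne' hx0 (by linarith)
    obtain ⟨m, x', hx', hx5, rfl⟩ := hK.exists_eq_pow_mul hp hq hr hx hx0
    obtain ⟨n, y', hy', hy5, hyy⟩ := hK.exists_eq_one_sub_pow_mul hp hq hr hy hy1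
    refine hgen m n ⟨hq, K, hK, x', hx', y', hy', hx5, hy5, ?_⟩
    have hpm : 0 < p ^ m := pow_pos hp.1 m
    rw [div_mul_eq_mul_div, eq_div_iff hpm.ne']
    linear_combination r * hyy + hxy
  · rintro _ rfl
    refine ⟨⟨0, hK.zero_mem ⟨hp.1, hp.2.trans_lt (by norm_num)⟩, ?_⟩,
      1, hK.one_mem ⟨hr.1, hr.2.trans_lt (by norm_num)⟩, ?_⟩ <;> simp [Spqr]

lemma IsAttractor.inter_eq_empty {p q r : ℝ} (hp : p ∈ Ioc (0:ℝ) (1/1000))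
    (hq : q ∈ Ioc (0:ℝ) (1/1000)) (hr : r ∈ Ioc (0:ℝ) (1/1000)) {K : Set ℝ}
    (hK : IsAttractor (Spqr p q r) K) {i j : Fin 6} (hij : i ≠ j)
    (hij' : ({i, j} : Set (Fin 6)) ≠ {2, 3}) :
    (Spqr p q r i '' K) ∩ (Spqr p q r j '' K) = ∅ := by
  rw [eq_empty_iff_forall_notMem]
  rintro z ⟨⟨x, hx, rfl⟩, y, hy, hxy⟩
  have h1 := Spqr_mem_Icc hp hq hr (hK.subset_Icc hp hq hr hx) i
  have h2 := Spqr_mem_Icc hp hq hr (hK.subset_Icc hp hq hr hy) j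
  rw [hxy] at h2
  have h3 := h1.1.trans h2.2
  have h4 := h2.1.trans h1.2
  have h23 : ¬ (i = 2 ∧ j = 3) := by rintro ⟨rfl, rfl⟩; exact hij' rfl
  have h32 : ¬ (i = 3 ∧ j = 2) := by rintro ⟨rfl, rfl⟩; exact hij' (pair_comm _ _)
  clear h1 h2 hxy hij'
  revert h3 h4 h23 h32 hij
  fin_cases i <;> fin_cases j <;> first | (norm_num; done) | simp

lemma irrational_log_pow_div_log_pow :
    Irrational (Real.log ((1/2) ^ 10) / Real.log ((1/3) ^ 7)) := by
  have h2 : 0 < Real.log 2 := Real.log_pos (by norm_num)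
  have h3 : 0 < Real.log 3 := Real.log_pos (by norm_num)
  have e : Real.log ((1/2) ^ 10) / Real.log ((1/3) ^ 7) = (10 * Real.log 2) / (7 * Real.log 3) := by
    simp only [Real.log_pow, one_div, Real.log_inv]
    push_cast
    rw [mul_neg, mul_neg, neg_div_neg_eq]
  rw [e]
  rintro ⟨s, hs⟩
  have hspos : 0 < s := by
    have : (0:ℝ) < s := by rw [hs]; positivity
    exact_mod_cast this
  have hnum : (s.num.toNat : ℤ) = s.num := Int.toNat_of_nonneg (Rat.num_pos.2 hspos).le
  have hs2 : (s : ℝ) = s.num.toNat / s.den := by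
    rw [Rat.cast_def, ← Int.cast_natCast s.num.toNat, hnum]
  have hden : (0:ℝ) < s.den := by exact_mod_cast s.den_pos
  rw [hs2, div_eq_div_iff hden.ne' (by positivity)] at hs
  have hlog : Real.log ((3:ℝ) ^ (7 * s.num.toNat)) = Real.log ((2:ℝ) ^ (10 * s.den)) := by
    rw [Real.log_pow, Real.log_pow]
    push_cast
    linarith
  have heq : (3:ℝ) ^ (7 * s.num.toNat) = 2 ^ (10 * s.den) :=
    Real.log_injOn_pos (by simp) (by simp) hlog
  have heq' : 3 ^ (7 * s.num.toNat) = 2 ^ (10 * s.den) := by exact_mod_cast heq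
  have hodd : Odd (3 ^ (7 * s.num.toNat)) := Odd.pow (by decide)
  rw [heq'] at hodd
  refine Nat.not_even_iff_odd.2 hodd (Even.pow_of_ne_zero (by decide) ?_)
  have := s.den_pos
  omega

/-- There exist `p, q, r ∈ (0, 1/36)` such that the system `S_pqr` does not satisfy the
open set condition, and yet for its attractor `K` the only nonempty intersection of
distinct pieces is `K₃ ∩ K₄ = {8/15}` (indices `2`, `3` in the 0-indexed notation). -/
theorem stmt0 :
    ∃ p q r : ℝ, p ∈ Ioo (0:ℝ) (1/36) ∧ q ∈ Ioo (0:ℝ) (1/36) ∧ r ∈ Ioo (0:ℝ) (1/36) ∧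
      ¬ SatisfiesOSC (Spqr p q r) ∧
      ∀ K : Set ℝ, IsAttractor (Spqr p q r) K →
        (Spqr p q r 2 '' K) ∩ (Spqr p q r 3 '' K) = {8/15} ∧
        ∀ i j : Fin 6, i ≠ j → ({i, j} : Set (Fin 6)) ≠ {2, 3} →
          (Spqr p q r i '' K) ∩ (Spqr p q r j '' K) = ∅ := by
  have hp : ((1/2) ^ 10 : ℝ) ∈ Ioc (0:ℝ) (1/1000) := by norm_num
  have hr : ((1/3) ^ 7 : ℝ) ∈ Ioc (0:ℝ) (1/1000) := by norm_num
  obtain ⟨q, hq, hgen⟩ := exists_notMem_exceptionalSet hp hr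
  exact ⟨(1/2) ^ 10, q, (1/3) ^ 7, by norm_num, ⟨hq.1, hq.2.trans_lt (by norm_num)⟩,
    by norm_num, not_satisfiesOSC_Spqr (by norm_num) hq.1 (by norm_num)
      irrational_log_pow_div_log_pow, fun K hK => ⟨hK.inter_eq_singleton hp hq hr hgen,
        fun i j hij hij' => hK.inter_eq_empty hp hq hr hij hij'⟩⟩
end

section
/- Let p, r ∈ (0, 1/36) with log p / log r irrational. Then for every q ∈ (0, 1/36) the system S_pqr fails the weak separation property: the identity map of ℝ is a limit (in the topology of pointwise convergence of affine maps, equivalently convergence of the coefficient pairs) of maps of the form S_j^{-1} ∘ S_i with i, j finite words over {1,...,6} and S_j^{-1} ∘ S_i ≠ Id. -/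
open Set Filter

/-- Coefficient pairs `(c, λ)` (representing the affine map `x ↦ c + λ x`) of the six
similarities of the system `S_pqr`, with `a = 1/5` and `h = 8/15`
(0-indexed: index `i : Fin 6` corresponds to `S_{i+1}`). -/
noncomputable def coefS (p q r : ℝ) : Fin 6 → ℝ × ℝ :=
  ![(0, p), (1/5, r), (8/15, -q), (8/15 - r, r), (1 - 1/5, -r), (1 - r, r)]

/-- Composition of affine maps of `ℝ` in coefficient form:
`(c₁ + λ₁ x) ∘ (c₂ + λ₂ x) = (c₁ + λ₁ c₂) + λ₁ λ₂ x`. -/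
def acomp (f g : ℝ × ℝ) : ℝ × ℝ := (f.1 + f.2 * g.1, f.2 * g.2)

/-- Inverse of an affine map of `ℝ` in coefficient form. -/
noncomputable def ainv (f : ℝ × ℝ) : ℝ × ℝ := (-f.1 / f.2, 1 / f.2)

/-- Coefficient pair of the composition `S_{i₁} ∘ ⋯ ∘ S_{iₙ}` along a finite word. -/
noncomputable def wcoef (p q r : ℝ) (w : List (Fin 6)) : ℝ × ℝ :=
  w.foldl (fun acc i => acomp acc (coefS p q r i)) (0, 1)

/-- The nonnegative multiples of an irrational number are dense modulo `1`. -/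
theorem Irrational.exists_nat_mul_sub_int_mem {α : ℝ} (hα : Irrational α) {U : Set ℝ}
    (hU : IsOpen U) (hne : U.Nonempty) : ∃ (n : ℕ) (k : ℤ), (n : ℝ) * α - k ∈ U := by
  have : Fact ((0 : ℝ) < 1) := ⟨one_pos⟩
  have hdense : DenseRange (· • (α : AddCircle (1 : ℝ)) : ℕ → AddCircle (1 : ℝ)) :=
    denseRange_zsmul_iff_nsmul.1 (AddCircle.denseRange_zsmul_coe_iff.2 (by simpa using hα))
  have hopen : IsOpen ((↑) '' U : Set (AddCircle (1 : ℝ))) :=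
    QuotientAddGroup.isOpenMap_coe U hU
  obtain ⟨n, y, hy, hyn⟩ := hdense.exists_mem_open hopen (hne.image _)
  have hzero : ((n * α - y : ℝ) : AddCircle (1 : ℝ)) = 0 := by
    rw [AddCircle.coe_sub, hyn, ← nsmul_eq_mul, AddCircle.coe_nsmul, sub_self]
  obtain ⟨k, hk⟩ := (AddCircle.coe_eq_zero_iff _).1 hzero
  refine ⟨n, k, ?_⟩
  have hk' : (k : ℝ) = n * α - y := by simpa using hk
  rwa [hk', sub_sub_cancel]

theorem foldl_acomp_replicate_zero (p q r : ℝ) (n : ℕ) (f : ℝ × ℝ) :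
    (List.replicate n (0 : Fin 6)).foldl (fun acc i => acomp acc (coefS p q r i)) f =
      (f.1, f.2 * p ^ n) := by
  induction n generalizing f with
  | zero => simp
  | succ n ih =>
    rw [List.replicate_succ, List.foldl_cons, ih]
    ext <;> simp [acomp, coefS, pow_succ']
    ring

theorem foldl_acomp_replicate_five (p q r : ℝ) (m : ℕ) (f : ℝ × ℝ) :
    (List.replicate m (5 : Fin 6)).foldl (fun acc i => acomp acc (coefS p q r i)) f =
      (f.1 + f.2 * (1 - r ^ m), f.2 * r ^ m) := by
  induction m generalizing f with
  | zero => simp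
  | succ m ih =>
    rw [List.replicate_succ, List.foldl_cons, ih]
    ext <;> simp [acomp, coefS, pow_succ'] <;> ring

theorem wcoef_three_one_pow_five (p q r : ℝ) (n : ℕ) :
    wcoef p q r (2 :: (List.replicate n 0 ++ [4])) =
      (8 / 15 - q * p ^ n * (4 / 5), q * p ^ n * r) := by
  rw [wcoef, List.foldl_cons, List.foldl_append, foldl_acomp_replicate_zero]
  ext <;> simp [acomp, coefS]
  ring

theorem wcoef_four_six_pow_two (p q r : ℝ) (m : ℕ) :
    wcoef p q r (3 :: (List.replicate m 5 ++ [1])) =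
      (8 / 15 - r ^ (m + 1) * (4 / 5), r ^ (m + 1) * r) := by
  rw [wcoef, List.foldl_cons, List.foldl_append, foldl_acomp_replicate_five]
  ext
  · simp [acomp, coefS]
    ring
  · simp [acomp, coefS, pow_succ']

theorem acomp_ainv_wcoef (p q : ℝ) {r : ℝ} (hr : r ≠ 0) (n m : ℕ) :
    acomp (ainv (wcoef p q r (3 :: (List.replicate m 5 ++ [1]))))
        (wcoef p q r (2 :: (List.replicate n 0 ++ [4]))) =
      (4 / (5 * r) * (1 - q * p ^ n / r ^ (m + 1)), q * p ^ n / r ^ (m + 1)) := by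
  rw [wcoef_three_one_pow_five, wcoef_four_six_pow_two]
  ext <;> simp only [acomp, ainv] <;> field_simp
  ring

/-- The ratios `q pⁿ / rᵐ⁺¹` accumulate at `1` from below. -/
theorem exists_ratio_eq_rpow {p q r : ℝ} (hp : p ∈ Ioo (0 : ℝ) 1) (hr : r ∈ Ioo (0 : ℝ) 1)
    (hq : q ∈ Ioo (0 : ℝ) 1) (hirr : Irrational (Real.log p / Real.log r)) {δ : ℝ} (hδ : 0 < δ) :
    ∃ (n m : ℕ) (s : ℝ), s ∈ Ioo 0 δ ∧ q * p ^ n / r ^ (m + 1) = r ^ s := by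
  have hlr : Real.log r < 0 := Real.log_neg hr.1 hr.2
  set β := Real.log q / Real.log r
  have hβ : 0 < β := div_pos_of_neg_of_neg (Real.log_neg hq.1 hq.2) hlr
  obtain ⟨n, k, hk, hk'⟩ := hirr.exists_nat_mul_sub_int_mem
    (isOpen_Ioo (a := -β) (b := min 0 (δ - β)))
    (nonempty_Ioo.2 (lt_min (by linarith) (by linarith)))
  have hk0 : (n : ℝ) * (Real.log p / Real.log r) - k < 0 := hk'.trans_le (min_le_left _ _)
  have hkδ : (n : ℝ) * (Real.log p / Real.log r) - k < δ - β := hk'.trans_le (min_le_right _ _)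
  have hα : 0 < Real.log p / Real.log r := div_pos_of_neg_of_neg (Real.log_neg hp.1 hp.2) hlr
  have hkpos : (0 : ℝ) < k := by
    have : 0 ≤ (n : ℝ) * (Real.log p / Real.log r) := by positivity
    linarith
  obtain ⟨m, rfl⟩ : ∃ m : ℕ, k = ((m + 1 : ℕ) : ℤ) :=
    ⟨(k - 1).toNat, by have := Int.cast_pos.1 hkpos; lia⟩
  refine ⟨n, m, n * (Real.log p / Real.log r) - (m + 1 : ℕ) + β, ⟨?_, ?_⟩, ?_⟩
  · push_cast at *; linarith
  · push_cast at *; linarith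
  have hpow {x : ℝ} (hx : 0 < x) : r ^ (Real.log x / Real.log r) = x :=
    Real.rpow_logb hr.1 hr.2.ne hx
  rw [Real.rpow_add hr.1, Real.rpow_sub hr.1, hpow hq.1, mul_comm (n : ℝ), Real.rpow_mul hr.1.le,
    hpow hp.1, Real.rpow_natCast, Real.rpow_natCast]
  ring

/-- If `log p / log r` is irrational, then for every `q ∈ (0,1/36)` the system `S_pqr`
fails the weak separation property: the identity map (coefficients `(0,1)`) lies in the
closure of the set of maps `S_j⁻¹ ∘ S_i ≠ Id`, `i, j` finite words over `{1,…,6}`,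
in the topology of convergence of coefficient pairs. -/
theorem stmt1 (p r : ℝ) (hp : p ∈ Ioo (0:ℝ) (1/36)) (hr : r ∈ Ioo (0:ℝ) (1/36))
    (hirr : Irrational (Real.log p / Real.log r)) :
    ∀ q ∈ Ioo (0:ℝ) (1/36),
      ((0:ℝ), (1:ℝ)) ∈ closure {f : ℝ × ℝ |
        (∃ i j : List (Fin 6), f = acomp (ainv (wcoef p q r j)) (wcoef p q r i)) ∧
          f ≠ ((0:ℝ), (1:ℝ))} := by
  intro q hq
  have hr0 : r ≠ 0 := hr.1.ne'
  have hr1 : r < 1 := hr.2.trans (by norm_num)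
  have hp1 : p < 1 := hp.2.trans (by norm_num)
  have hq1 : q < 1 := hq.2.trans (by norm_num)
  let F : ℝ → ℝ × ℝ := fun s => (4 / (5 * r) * (1 - r ^ s), r ^ s)
  have hF : Continuous F := by
    have := Real.continuous_const_rpow hr0
    fun_prop
  have hF0 : F 0 = (0, 1) := by simp [F]
  refine mem_closure_iff.2 fun U hU h0 => ?_
  obtain ⟨δ, hδ, hball⟩ := Metric.isOpen_iff.1 (hU.preimage hF) 0 (by simpa [hF0] using h0)
  obtain ⟨n, m, s, hs, hratio⟩ :=
    exists_ratio_eq_rpow ⟨hp.1, hp1⟩ ⟨hr.1, hr1⟩ ⟨hq.1, hq1⟩ hirr hδ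
  have hFs := acomp_ainv_wcoef p q hr0 n m
  rw [hratio] at hFs
  refine ⟨F s, hball ?_, ⟨_, _, hFs.symm⟩, fun h => ?_⟩
  · simpa [Real.dist_eq, abs_of_pos hs.1] using hs.2
  · exact (Real.rpow_lt_one hr.1.le hr1 hs.1).ne (congrArg Prod.snd h)
end

section
/- Let p, r ∈ (0,1) with log p / log r irrational. Then for every q > 0 there exist sequences of natural numbers (m_k) and (n_k) such that p^{−m_k} · r^{n_k + 1} converges to q as k → ∞. -/
open Set Filter

/-- If `a, b > 0` and `a / b` is irrational, then the differences of a natural multiple of `a` and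
a positive natural multiple of `b` are dense in `ℝ`. -/
theorem denseRange_nat_mul_sub_nat_succ_mul {a b : ℝ} (ha : 0 < a) (hb : 0 < b)
    (hab : Irrational (a / b)) :
    DenseRange fun x : ℕ × ℕ => (x.1 : ℝ) * a - ((x.2 : ℝ) + 1) * b := by
  intro t
  rw [Metric.mem_closure_range_iff]
  intro ε hε
  have : Fact (0 < b) := ⟨hb⟩
  have hcluster : MapClusterPt (t : AddCircle b) atTop fun m : ℕ => m • (a : AddCircle b) :=
    ((mapClusterPt_atTop_nsmul_tfae _ _).out 0 3).2 (AddCircle.denseRange_zsmul_coe_iff.2 hab _)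
  have hnhds : ((↑) : ℝ → AddCircle b) '' Metric.ball t ε ∈ nhds (t : AddCircle b) :=
    QuotientAddGroup.isOpenMap_coe.image_mem_nhds (Metric.ball_mem_nhds t hε)
  have hlarge : ∀ᶠ m : ℕ in atTop, t + ε < m * a :=
    (tendsto_natCast_atTop_atTop.atTop_mul_const ha).eventually_gt_atTop _
  obtain ⟨m, ⟨x, hx, hxm⟩, hm⟩ := ((hcluster.frequently hnhds).and_eventually hlarge).exists
  rw [← AddCircle.coe_nsmul, eq_comm, ← sub_eq_zero, ← AddCircle.coe_sub,
    AddCircle.coe_eq_zero_iff] at hxm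
  obtain ⟨z, hz⟩ := hxm
  rw [zsmul_eq_mul, nsmul_eq_mul] at hz
  rw [Metric.mem_ball, Real.dist_eq] at hx
  have hz_pos : 0 < z := by
    have : 0 < (z : ℝ) * b := by linarith [(abs_lt.1 hx).2]
    exact_mod_cast pos_of_mul_pos_left this hb.le
  obtain ⟨n, rfl⟩ : ∃ n : ℕ, z = n + 1 := ⟨(z - 1).toNat, by omega⟩
  push_cast at hz
  refine ⟨(m, n), ?_⟩
  rwa [dist_comm, Real.dist_eq, hz, sub_sub_cancel]

/-- If `p, r ∈ (0,1)` and `log p / log r` is irrational, then for every `q > 0` there are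
sequences of natural numbers `(m_k)`, `(n_k)` with `p^{−m_k} · r^{n_k+1} → q`. -/
theorem stmt3 (p r : ℝ) (hp : p ∈ Ioo (0:ℝ) 1) (hr : r ∈ Ioo (0:ℝ) 1)
    (hirr : Irrational (Real.log p / Real.log r)) :
    ∀ q : ℝ, 0 < q → ∃ m n : ℕ → ℕ,
      Tendsto (fun k => r ^ (n k + 1) / p ^ (m k)) atTop (nhds q) := by
  intro q hq
  have hdense := denseRange_nat_mul_sub_nat_succ_mul
    (neg_pos.2 (Real.log_neg hp.1 hp.2)) (neg_pos.2 (Real.log_neg hr.1 hr.2))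
    (by rwa [neg_div_neg_eq])
  obtain ⟨u, hu, hlim⟩ := mem_closure_iff_seq_limit.1 (hdense (Real.log q))
  choose x hx using hu
  refine ⟨fun k => (x k).1, fun k => (x k).2, ?_⟩
  have hexp := (Real.continuous_exp.tendsto _).comp hlim
  rw [Real.exp_log hq] at hexp
  refine hexp.congr fun k => ?_
  rw [Function.comp_apply, ← hx k, ← Real.exp_log (div_pos (pow_pos hr.1 _) (pow_pos hp.1 _)),
    Real.log_div (pow_pos hr.1 _).ne' (pow_pos hp.1 _).ne', Real.log_pow, Real.log_pow]
  push_cast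
  ring_nf
end

section
/- Let (D, ρ), (L_1, σ_1), (L_2, σ_2) be metric spaces and let φ_1 : D × L_1 → ℝ^n and φ_2 : D × L_2 → ℝ^n be continuous maps such that (a) there are constants C > 0 and α ∈ (0,1] with ‖φ_i(ξ, x) − φ_i(ξ, x')‖ ≤ C · σ_i(x, x')^α for all ξ ∈ D and x, x' ∈ L_i (i = 1,2), and (b) there is M > 0 such that for all x_1 ∈ L_1, x_2 ∈ L_2, ξ, ξ' ∈ D, the function Φ(ξ, x_1, x_2) = φ_1(ξ, x_1) − φ_2(ξ, x_2) satisfies ‖Φ(ξ', x_1, x_2) − Φ(ξ, x_1, x_2)‖ ≥ M · ρ(ξ', ξ). Then the set Δ = {ξ ∈ D : φ_1(ξ, L_1) ∩ φ_2(ξ, L_2) ≠ ∅} has Hausdorff dimension dim_H Δ ≤ dim_H(L_1 × L_2) / α. -/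
open Set

/-- General Position Theorem: if `φ₁ : D × L₁ → ℝⁿ` and `φ₂ : D × L₂ → ℝⁿ` are continuous,
`α`-Hölder in the second variable, and `Φ(ξ,x₁,x₂) = φ₁(ξ,x₁) − φ₂(ξ,x₂)` is expanding in
`ξ` with constant `M > 0`, then the set `Δ = {ξ : φ₁(ξ,L₁) ∩ φ₂(ξ,L₂) ≠ ∅}` has Hausdorff
dimension at most `dim_H (L₁ × L₂) / α`. -/
theorem stmt4 {D L₁ L₂ : Type*} [MetricSpace D] [MetricSpace L₁] [MetricSpace L₂]
    (n : ℕ)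
    (φ₁ : D × L₁ → EuclideanSpace ℝ (Fin n)) (φ₂ : D × L₂ → EuclideanSpace ℝ (Fin n))
    (hc₁ : Continuous φ₁) (hc₂ : Continuous φ₂)
    (C : ℝ) (hC : 0 < C) (α : ℝ) (hα : α ∈ Ioc (0:ℝ) 1)
    (hH₁ : ∀ (ξ : D) (x x' : L₁), ‖φ₁ (ξ, x) - φ₁ (ξ, x')‖ ≤ C * dist x x' ^ α)
    (hH₂ : ∀ (ξ : D) (x x' : L₂), ‖φ₂ (ξ, x) - φ₂ (ξ, x')‖ ≤ C * dist x x' ^ α)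
    (M : ℝ) (hM : 0 < M)
    (hΦ : ∀ (x₁ : L₁) (x₂ : L₂) (ξ ξ' : D),
      ‖(φ₁ (ξ', x₁) - φ₂ (ξ', x₂)) - (φ₁ (ξ, x₁) - φ₂ (ξ, x₂))‖ ≥ M * dist ξ' ξ) :
    dimH {ξ : D | ∃ (x₁ : L₁) (x₂ : L₂), φ₁ (ξ, x₁) = φ₂ (ξ, x₂)} ≤
      dimH (univ : Set (L₁ × L₂)) / ENNReal.ofReal α := by
  obtain ⟨hα₀, -⟩ := hα
  rcases isEmpty_or_nonempty D with hD | hD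
  · simp [Set.eq_empty_of_isEmpty]
  have hsel : ∀ p : L₁ × L₂, ∃ ξ : D, (∃ η : D, φ₁ (η, p.1) = φ₂ (η, p.2)) →
      φ₁ (ξ, p.1) = φ₂ (ξ, p.2) := fun p ↦ by
    by_cases h : ∃ η : D, φ₁ (η, p.1) = φ₂ (η, p.2)
    · exact h.imp fun η hη _ ↦ hη
    · exact ⟨hD.some, fun h' ↦ absurd h' h⟩
  choose f hf using hsel
  set S : Set (L₁ × L₂) := {p | ∃ η : D, φ₁ (η, p.1) = φ₂ (η, p.2)} with hS
  -- Uniqueness of the parameter at which two given points collide.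
  have himage : {ξ : D | ∃ (x₁ : L₁) (x₂ : L₂), φ₁ (ξ, x₁) = φ₂ (ξ, x₂)} ⊆ f '' S := by
    rintro ξ ⟨x₁, x₂, h⟩
    refine ⟨(x₁, x₂), ⟨ξ, h⟩, ?_⟩
    have h' : φ₁ (f (x₁, x₂), x₁) = φ₂ (f (x₁, x₂), x₂) := hf (x₁, x₂) ⟨ξ, h⟩
    have hd := hΦ x₁ x₂ ξ (f (x₁, x₂))
    rw [h, h', sub_self, sub_self, sub_self, norm_zero] at hd
    exact dist_le_zero.1 (nonpos_of_mul_nonpos_right hd hM)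
  have hdist : ∀ p ∈ S, ∀ q ∈ S, dist (f p) (f q) ≤ 2 * C / M * dist p q ^ α := by
    intro p hp q hq
    have hd := hΦ q.1 q.2 (f q) (f p)
    have e₁ := (hH₁ (f p) q.1 p.1).trans (mul_le_mul_of_nonneg_left
      (Real.rpow_le_rpow dist_nonneg
        ((dist_comm q.1 p.1).trans_le (le_max_left _ (dist p.2 q.2))) hα₀.le) hC.le)
    have e₂ := (hH₂ (f p) q.2 p.2).trans (mul_le_mul_of_nonneg_left
      (Real.rpow_le_rpow dist_nonneg
        ((dist_comm q.2 p.2).trans_le (le_max_right (dist p.1 q.1) _)) hα₀.le) hC.le)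
    rw [← Prod.dist_eq] at e₁ e₂
    have hsplit : (φ₁ (f p, q.1) - φ₂ (f p, q.2)) - (φ₁ (f q, q.1) - φ₂ (f q, q.2)) =
        (φ₁ (f p, q.1) - φ₁ (f p, p.1)) - (φ₂ (f p, q.2) - φ₂ (f p, p.2)) := by
      rw [hf q hq, hf p hp]
      abel
    rw [hsplit] at hd
    have htri := norm_sub_le (φ₁ (f p, q.1) - φ₁ (f p, p.1)) (φ₂ (f p, q.2) - φ₂ (f p, p.2))
    rw [div_mul_eq_mul_div, le_div_iff₀ hM]
    linarith
  have hholder : HolderOnWith (2 * C / M).toNNReal α.toNNReal f S := by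
    intro p hp q hq
    have hK : 0 ≤ 2 * C / M := by positivity
    rw [edist_dist, edist_dist, Real.coe_toNNReal _ hα₀.le,
      ENNReal.ofReal_rpow_of_nonneg dist_nonneg hα₀.le]
    change _ ≤ ENNReal.ofReal (2 * C / M) * _
    rw [← ENNReal.ofReal_mul hK]
    exact ENNReal.ofReal_le_ofReal (hdist p hp q hq)
  calc dimH {ξ : D | ∃ (x₁ : L₁) (x₂ : L₂), φ₁ (ξ, x₁) = φ₂ (ξ, x₂)}
      ≤ dimH (f '' S) := dimH_mono himage
    _ ≤ dimH S / ENNReal.ofReal α := hholder.dimH_image_le (Real.toNNReal_pos.2 hα₀)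
    _ ≤ dimH (univ : Set (L₁ × L₂)) / ENNReal.ofReal α :=
        ENNReal.div_le_div_right (dimH_mono (subset_univ S)) _
end

section
/- Let S = {S_1,...,S_m} and S' = {S'_1,...,S'_m} be two systems of contraction maps of ℝ^n, and let π : I^∞ → ℝ^n and π' : I^∞ → ℝ^n be their address maps, where I = {1,...,m}. Suppose V ⊆ ℝ^n is a nonempty compact set with S_i(V) ⊆ V and S'_i(V) ⊆ V for all i. Then for every σ ∈ I^∞, ‖π(σ) − π'(σ)‖ ≤ δ/(1 − R), where R = max over i of the Lipschitz constants of S_i and S'_i (assumed < 1), and δ = max over x ∈ V and i ∈ I of ‖S'_i(x) − S_i(x)‖. -/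
open Set

/-- `word T σ k` is the composition `T_{σ₀} ∘ T_{σ₁} ∘ ⋯ ∘ T_{σ_{k-1}}` of the first `k`
maps along the address `σ`. -/
def word {E : Type*} {m : ℕ} (T : Fin m → E → E) (σ : ℕ → Fin m) : ℕ → E → E
  | 0 => id
  | k + 1 => word T σ k ∘ T (σ k)

/-- If `S` and `T` are systems of `R`-Lipschitz maps that are `δ`-close on an invariant set `V`,
then their compositions along the same address satisfy the geometric displacement bound. -/
theorem dist_word_le {E : Type*} [PseudoMetricSpace E] {m : ℕ} {S T : Fin m → E → E}
    {R : NNReal} (hR : R < 1) (hS : ∀ i, LipschitzWith R (S i)) {V : Set E}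
    (hSV : ∀ i, MapsTo (S i) V V) (hTV : ∀ i, MapsTo (T i) V V)
    {δ : ℝ} (hδ : ∀ x ∈ V, ∀ i, dist (S i x) (T i x) ≤ δ) (σ : ℕ → Fin m) (k : ℕ) :
    ∀ x ∈ V, ∀ y ∈ V, dist (word S σ k x) (word T σ k y) ≤
      δ / (1 - (R : ℝ)) * (1 - (R : ℝ) ^ k) + (R : ℝ) ^ k * dist x y := by
  have hR' : (1 - (R : ℝ)) ≠ 0 := (sub_pos.2 (by exact_mod_cast hR)).ne'
  induction k with
  | zero => simp [word]
  | succ k ih =>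
    intro x hx y hy
    have step : dist (S (σ k) x) (T (σ k) y) ≤ R * dist x y + δ :=
      (dist_triangle _ (S (σ k) y) _).trans
        (add_le_add ((hS (σ k)).dist_le_mul x y) (hδ y hy (σ k)))
    calc dist (word S σ (k + 1) x) (word T σ (k + 1) y)
        ≤ δ / (1 - (R : ℝ)) * (1 - (R : ℝ) ^ k)
            + (R : ℝ) ^ k * dist (S (σ k) x) (T (σ k) y) :=
          ih _ (hSV (σ k) hx) _ (hTV (σ k) hy)
      _ ≤ δ / (1 - (R : ℝ)) * (1 - (R : ℝ) ^ k) + (R : ℝ) ^ k * (R * dist x y + δ) := by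
          gcongr
      _ = δ / (1 - (R : ℝ)) * (1 - (R : ℝ) ^ (k + 1)) + (R : ℝ) ^ (k + 1) * dist x y := by
          field_simp
          ring

/-- Displacement Theorem: if `S` and `S'` are two systems of `m` contractions of `ℝⁿ` with
contraction ratios at most `R < 1`, both leaving a nonempty compact set `V` invariant, and
`‖S'_i(x) − S_i(x)‖ ≤ δ` on `V`, then the address maps `π, π'` (characterized by
`{π σ} = ⋂ₖ S_{σ₁} ∘ ⋯ ∘ S_{σₖ}(V)`) satisfy `‖π(σ) − π'(σ)‖ ≤ δ/(1 − R)`. -/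
theorem stmt6 {n m : ℕ} (hm : 0 < m)
    (Sf S'f : Fin m → EuclideanSpace ℝ (Fin n) → EuclideanSpace ℝ (Fin n))
    (R : NNReal) (hR : R < 1)
    (hLip : ∀ i, LipschitzWith R (Sf i) ∧ LipschitzWith R (S'f i))
    (V : Set (EuclideanSpace ℝ (Fin n))) (hV : V.Nonempty) (hVc : IsCompact V)
    (hSV : ∀ i, Sf i '' V ⊆ V) (hS'V : ∀ i, S'f i '' V ⊆ V)
    (π π' : (ℕ → Fin m) → EuclideanSpace ℝ (Fin n))
    (hπ : ∀ σ, ({π σ} : Set (EuclideanSpace ℝ (Fin n))) = ⋂ k : ℕ, word Sf σ k '' V)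
    (hπ' : ∀ σ, ({π' σ} : Set (EuclideanSpace ℝ (Fin n))) = ⋂ k : ℕ, word S'f σ k '' V)
    (δ : ℝ) (hδ : ∀ x ∈ V, ∀ i, ‖S'f i x - Sf i x‖ ≤ δ) :
    ∀ σ : ℕ → Fin m, ‖π σ - π' σ‖ ≤ δ / (1 - (R : ℝ)) := by
  intro σ
  have hlim : Filter.Tendsto (fun k : ℕ => δ / (1 - (R : ℝ)) * (1 - (R : ℝ) ^ k)
      + (R : ℝ) ^ k * Metric.diam V) Filter.atTop (nhds (δ / (1 - (R : ℝ)))) := by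
    have hpow := tendsto_pow_atTop_nhds_zero_of_lt_one R.coe_nonneg (by exact_mod_cast hR)
    simpa using ((hpow.const_sub 1).const_mul (δ / (1 - (R : ℝ)))).add
      (hpow.mul_const (Metric.diam V))
  refine ge_of_tendsto' hlim fun k => ?_
  obtain ⟨x, hx, hxπ⟩ := mem_iInter.1 ((hπ σ).subset rfl) k
  obtain ⟨y, hy, hyπ⟩ := mem_iInter.1 ((hπ' σ).subset rfl) k
  rw [← dist_eq_norm, ← hxπ, ← hyπ]
  refine (dist_word_le hR (fun i => (hLip i).1) (fun i => mapsTo_iff_image_subset.2 (hSV i))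
    (fun i => mapsTo_iff_image_subset.2 (hS'V i))
    (fun z hz i => by simpa only [dist_eq_norm'] using hδ z hz i) σ k x hx y hy).trans ?_
  gcongr
  exact Metric.dist_le_diam_of_mem hVc.isBounded hx hy
end

section
/- Let p, q, r ∈ (0, 1/36) be such that the system S_pqr has unique one-point intersection (K_3 ∩ K_4 = {h} and all other pairwise intersections of pieces empty). Then the Hausdorff dimension of the attractor K_pqr equals the similarity dimension s of the system S_pqr, i.e. the unique s > 0 satisfying p^s + q^s + 4·r^s = 1. -/
open Set

/-- `S_pqr` (with attractor `K`) has unique one-point intersection: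
`K₃ ∩ K₄ = {8/15}` (indices `2, 3` here) and all other pairwise intersections of
distinct pieces are empty. -/
def UniqueOnePointIntersection (p q r : ℝ) (K : Set ℝ) : Prop :=
  (Spqr p q r 2 '' K) ∩ (Spqr p q r 3 '' K) = {8/15} ∧
    ∀ i j : Fin 6, i ≠ j → ({i, j} : Set (Fin 6)) ≠ {2, 3} →
      (Spqr p q r i '' K) ∩ (Spqr p q r j '' K) = ∅

open Metric MeasureTheory Filter Topology
open scoped NNReal ENNReal

section HausdorffMeasure

variable {X : Type*} [MetricSpace X]

theorem exists_isOpen_superset_ediam_rpow_le {A : Set X} (hA : ediam A ≠ ∞) {d : ℝ} (hd : 0 ≤ d)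
    {ε : ℝ≥0} (hε : 0 < ε) :
    ∃ U, IsOpen U ∧ A ⊆ U ∧ ediam U ^ d ≤ ediam A ^ d + ε := by
  have hcont : Tendsto (fun e : ℝ≥0 => (ediam A + 2 * e) ^ d) (𝓝[>] 0) (𝓝 (ediam A ^ d)) := by
    have h : Continuous fun e : ℝ≥0 => (ediam A + 2 * (e : ℝ≥0∞)) ^ d :=
      ENNReal.continuous_rpow_const.comp (continuous_const.add
        ((ENNReal.continuous_const_mul (by simp)).comp ENNReal.continuous_coe))
    simpa using (h.tendsto 0).mono_left nhdsWithin_le_nhds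
  have hlt : ediam A ^ d < ediam A ^ d + ε :=
    ENNReal.lt_add_right (ENNReal.rpow_ne_top_of_nonneg hd hA) (by simpa using hε.ne')
  obtain ⟨e, he, he0⟩ := ((hcont.eventually_lt_const hlt).and self_mem_nhdsWithin).exists
  exact ⟨thickening e A, isOpen_thickening, self_subset_thickening (by exact_mod_cast he0) A,
    (ENNReal.rpow_le_rpow (ediam_thickening_le e) hd).trans he.le⟩

/-- A lower bound for the sums over finite covers of a compact set bounds its Hausdorff measure. -/
theorem le_hausdorffMeasure_of_forall_finset_cover [MeasurableSpace X] [BorelSpace X]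
    {K : Set X} (hK : IsCompact K) {d : ℝ} (hd : 0 < d) {c : ℝ≥0∞}
    (h : ∀ (U : ℕ → Set X) (J : Finset ℕ), K ⊆ ⋃ j ∈ J, U j → c ≤ ∑ j ∈ J, ediam (U j) ^ d) :
    c ≤ μH[d] K := by
  rw [Measure.hausdorffMeasure_apply]
  refine le_iSup₂_of_le 1 one_pos (le_iInf fun A => le_iInf fun hKA => le_iInf fun hA => ?_)
  have hsup (n : ℕ) : ⨆ _ : (A n).Nonempty, ediam (A n) ^ d = ediam (A n) ^ d := by
    rcases (A n).eq_empty_or_nonempty with hn | hn <;> simp [hn, hd]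
  simp_rw [hsup]
  refine ENNReal.le_of_forall_pos_le_add fun ε hε _ => ?_
  obtain ⟨ε', hε', hsum⟩ := ENNReal.exists_pos_sum_of_countable (ENNReal.coe_ne_zero.2 hε.ne') ℕ
  choose U hUo hAU hU using fun n => exists_isOpen_superset_ediam_rpow_le
    (ne_top_of_le_ne_top ENNReal.one_ne_top (hA n)) hd.le (hε' n)
  obtain ⟨J, hJ⟩ := hK.elim_finite_subcover U hUo (hKA.trans (iUnion_mono hAU))
  calc c ≤ ∑ j ∈ J, ediam (U j) ^ d := h U J hJ
    _ ≤ ∑' j, ediam (U j) ^ d := ENNReal.sum_le_tsum J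
    _ ≤ ∑' j, (ediam (A j) ^ d + ε' j) := ENNReal.tsum_le_tsum hU
    _ = ∑' j, ediam (A j) ^ d + ∑' j, (ε' j : ℝ≥0∞) := ENNReal.tsum_add
    _ ≤ ∑' j, ediam (A j) ^ d + ε := by gcongr

variable {ι : Type*} [Fintype ι] {f : ι → X → X} {ρ : ι → ℝ≥0} {K : Set X} {t : ℝ}

theorem rpow_le_sum_ediam_rpow_of_separated [Nontrivial ι]
    (hρ : ∀ i, 0 < ρ i) (hf : ∀ i, AntilipschitzWith (ρ i)⁻¹ (f i)) (hK : K.Nonempty)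
    (hfK : ∀ i, MapsTo (f i) K K) {δ : ℝ≥0∞}
    (hδ : ∀ i j, i ≠ j → ∀ x ∈ K, ∀ y ∈ K, δ ≤ edist (f i x) (f j y))
    (ht : 0 ≤ t) (hsum : 1 ≤ ∑ i, (ρ i : ℝ≥0∞) ^ t) (J : Finset ℕ) (U : ℕ → Set X)
    (hU : K ⊆ ⋃ j ∈ J, U j) : δ ^ t ≤ ∑ j ∈ J, ediam (U j) ^ t := by
  classical
  induction J using Finset.strongInduction generalizing U with
  | H J ih =>
  by_cases hbig : ∃ j ∈ J, δ ≤ ediam (U j)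
  · obtain ⟨j, hj, hδj⟩ := hbig
    exact (ENNReal.rpow_le_rpow hδj ht).trans
      (Finset.single_le_sum (f := fun j => ediam (U j) ^ t) (fun _ _ => zero_le) hj)
  push Not at hbig
  let N (i : ι) : Finset ℕ := {j ∈ J | (U j ∩ f i '' K).Nonempty}
  have hdisj : ∀ i i', i ≠ i' → Disjoint (N i) (N i') := by
    intro i i' hii'
    refine Finset.disjoint_left.2 fun j hj hj' => ?_
    obtain ⟨hjJ, _, hx, x, hxK, rfl⟩ := Finset.mem_filter.1 hj
    obtain ⟨-, _, hy, y, hyK, rfl⟩ := Finset.mem_filter.1 hj'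
    exact (hδ i i' hii' x hxK y hyK).not_gt ((edist_le_ediam_of_mem hx hy).trans_lt (hbig j hjJ))
  have hcover (i : ι) : K ⊆ ⋃ j ∈ N i, f i ⁻¹' U j := by
    intro x hx
    obtain ⟨j, hj, hxj⟩ := mem_iUnion₂.1 (hU (hfK i hx))
    exact mem_iUnion₂.2 ⟨j, Finset.mem_filter.2 ⟨hj, f i x, hxj, x, hx, rfl⟩, hxj⟩
  have hssub (i : ι) : N i ⊂ J := by
    refine (Finset.filter_subset _ _).ssubset_of_ne fun hNJ => ?_
    obtain ⟨i', hi'⟩ := exists_ne i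
    obtain ⟨x, hx⟩ := hK
    obtain ⟨j, hj, -⟩ := mem_iUnion₂.1 (hcover i' hx)
    exact Finset.disjoint_left.1 (hdisj i' i hi') hj
      (hNJ.symm.subset (Finset.filter_subset _ _ hj))
  have hpre (i : ι) (A : Set X) : (ρ i : ℝ≥0∞) * ediam (f i ⁻¹' A) ≤ ediam A := by
    refine (mul_le_mul_right ((hf i).ediam_preimage_le A) _).trans_eq ?_
    rw [← mul_assoc, ← ENNReal.coe_mul, mul_inv_cancel₀ (hρ i).ne', ENNReal.coe_one, one_mul]
  calc δ ^ t ≤ (∑ i, (ρ i : ℝ≥0∞) ^ t) * δ ^ t := le_mul_of_one_le_left zero_le hsum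
    _ ≤ ∑ i, (ρ i : ℝ≥0∞) ^ t * ∑ j ∈ N i, ediam (f i ⁻¹' U j) ^ t := by
        rw [Finset.sum_mul]
        gcongr with i
        exact ih (N i) (hssub i) _ (hcover i)
    _ ≤ ∑ i, ∑ j ∈ N i, ediam (U j) ^ t := by
        gcongr with i
        rw [Finset.mul_sum]
        gcongr with j
        rw [← ENNReal.mul_rpow_of_nonneg _ _ ht]
        exact ENNReal.rpow_le_rpow (hpre i _) ht
    _ = ∑ j ∈ Finset.univ.biUnion N, ediam (U j) ^ t :=
        (Finset.sum_biUnion fun i _ i' _ hii' => hdisj i i' hii').symm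
    _ ≤ ∑ j ∈ J, ediam (U j) ^ t :=
        Finset.sum_le_sum_of_subset (Finset.biUnion_subset.2 fun i _ => Finset.filter_subset _ _)

theorem exists_pos_forall_le_edist_of_disjoint_images (hf : ∀ i, Continuous (f i))
    (hK : IsCompact K) (hdisj : ∀ i j, i ≠ j → Disjoint (f i '' K) (f j '' K)) :
    ∃ δ : ℝ≥0, 0 < δ ∧ ∀ i j, i ≠ j → ∀ x ∈ K, ∀ y ∈ K, (δ : ℝ≥0∞) ≤ edist (f i x) (f j y) := by
  have h (k : ι × ι) : ∃ δ : ℝ≥0, 0 < δ ∧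
      (k.1 ≠ k.2 → ∀ x ∈ K, ∀ y ∈ K, (δ : ℝ≥0∞) ≤ edist (f k.1 x) (f k.2 y)) := by
    by_cases hk : k.1 = k.2
    · exact ⟨1, one_pos, fun h => absurd hk h⟩
    · obtain ⟨δ, hδ, h⟩ := exists_pos_forall_lt_edist (hK.image (hf k.1))
        (hK.image (hf k.2)).isClosed (hdisj _ _ hk)
      exact ⟨δ, hδ, fun _ x hx y hy =>
        (h _ (mem_image_of_mem _ hx) _ (mem_image_of_mem _ hy)).le⟩
  choose δ hδ h using h
  obtain ⟨ε, hε, hεδ⟩ : ∃ ε : ℝ≥0, 0 < ε ∧ ∀ k, ε ≤ δ k := by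
    rcases isEmpty_or_nonempty (ι × ι) with _ | _
    · exact ⟨1, one_pos, isEmptyElim⟩
    · obtain ⟨k, hk⟩ := Finite.exists_min δ
      exact ⟨δ k, hδ k, hk⟩
  exact ⟨ε, hε, fun i j hij x hx y hy =>
    (ENNReal.coe_le_coe.2 (hεδ (i, j))).trans (h (i, j) hij x hx y hy)⟩

/-- A compact set that contains its pairwise disjoint images under finitely many similarities has
dimension at least `t` as soon as the `t`-th powers of the ratios sum to at least `1`. -/
theorem ofReal_le_dimH_of_disjoint_similar_images (hρ : ∀ i, 0 < ρ i) (hρ1 : ∀ i, ρ i < 1)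
    (hf : ∀ i x y, edist (f i x) (f i y) = ρ i * edist x y) (hK : IsCompact K) (hne : K.Nonempty)
    (hfK : ∀ i, MapsTo (f i) K K) (hdisj : ∀ i j, i ≠ j → Disjoint (f i '' K) (f j '' K))
    (ht : 0 < t) (hsum : 1 ≤ ∑ i, ρ i ^ t) : ENNReal.ofReal t ≤ dimH K := by
  borelize X
  have : Nontrivial ι := by
    by_contra h
    rw [not_nontrivial_iff_subsingleton] at h
    rcases isEmpty_or_nonempty ι with _ | ⟨⟨i⟩⟩
    · simp at hsum
    · rw [Fintype.sum_subsingleton _ i] at hsum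
      exact hsum.not_gt (NNReal.rpow_lt_one (hρ1 i) ht)
  have hanti (i : ι) : AntilipschitzWith (ρ i)⁻¹ (f i) := fun x y => by
    rw [hf, ← mul_assoc, ← ENNReal.coe_mul, inv_mul_cancel₀ (hρ i).ne', ENNReal.coe_one, one_mul]
  have hlip (i : ι) : LipschitzWith (ρ i) (f i) := fun x y => (hf i x y).le
  obtain ⟨δ, hδ, hδf⟩ :=
    exists_pos_forall_le_edist_of_disjoint_images (fun i => (hlip i).continuous) hK hdisj
  have hsum' : 1 ≤ ∑ i, (ρ i : ℝ≥0∞) ^ t := by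
    simp_rw [← ENNReal.coe_rpow_of_nonneg _ ht.le]
    exact_mod_cast hsum
  have hμ : (δ : ℝ≥0∞) ^ t ≤ μH[t] K :=
    le_hausdorffMeasure_of_forall_finset_cover hK ht fun U J hU =>
      rpow_le_sum_ediam_rpow_of_separated hρ hanti hne hfK hδf ht.le hsum' J U hU
  have hpos : 0 < (δ : ℝ≥0∞) ^ t := ENNReal.rpow_pos (by simpa using hδ) (by simp)
  refine le_dimH_of_hausdorffMeasure_ne_zero ?_
  rw [Real.coe_toNNReal t ht.le]
  exact (hpos.trans_le hμ).ne'

end HausdorffMeasure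

section Attractor

variable {X : Type*} [MetricSpace X] {ι : Type} [Fintype ι] {f : ι → X → X} {ρ : ι → ℝ≥0}
  {K : Set X} {t : ℝ}

theorem exists_iterated_cover (hf : ∀ i, LipschitzWith (ρ i) (f i)) (hK : K ⊆ ⋃ i, f i '' K)
    {b : ℝ≥0} (hb : ∀ i, ρ i ≤ b) (ht : 0 ≤ t) (hsum : ∑ i, ρ i ^ t ≤ 1) (n : ℕ) :
    ∃ (κ : Type) (_ : Fintype κ) (A : κ → Set X), K ⊆ ⋃ k, A k ∧
      (∀ k, ediam (A k) ≤ (b : ℝ≥0∞) ^ n * ediam K) ∧ ∑ k, ediam (A k) ^ t ≤ ediam K ^ t := by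
  induction n with
  | zero => exact ⟨Unit, inferInstance, fun _ => K, (iUnion_const K).ge, by simp, by simp⟩
  | succ n ih =>
    obtain ⟨κ, _, A, hKA, hA, hAsum⟩ := ih
    refine ⟨ι × κ, inferInstance, fun x => f x.1 '' A x.2, fun x hx => ?_, fun x => ?_, ?_⟩
    · obtain ⟨i, y, hy, rfl⟩ := mem_iUnion.1 (hK hx)
      obtain ⟨k, hk⟩ := mem_iUnion.1 (hKA hy)
      exact mem_iUnion.2 ⟨(i, k), y, hk, rfl⟩
    · calc ediam (f x.1 '' A x.2) ≤ ρ x.1 * ediam (A x.2) := (hf x.1).ediam_image_le _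
        _ ≤ b * ((b : ℝ≥0∞) ^ n * ediam K) := by gcongr <;> simp [hb, hA]
        _ = (b : ℝ≥0∞) ^ (n + 1) * ediam K := by rw [pow_succ', mul_assoc]
    · have hsum' : ∑ i, (ρ i : ℝ≥0∞) ^ t ≤ 1 := by
        simp_rw [← ENNReal.coe_rpow_of_nonneg _ ht]
        exact_mod_cast hsum
      calc ∑ x : ι × κ, ediam (f x.1 '' A x.2) ^ t
          ≤ ∑ x : ι × κ, (ρ x.1 : ℝ≥0∞) ^ t * ediam (A x.2) ^ t := by
            gcongr with x
            rw [← ENNReal.mul_rpow_of_nonneg _ _ ht]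
            exact ENNReal.rpow_le_rpow ((hf x.1).ediam_image_le _) ht
        _ = (∑ i, (ρ i : ℝ≥0∞) ^ t) * ∑ k, ediam (A k) ^ t := by
            rw [Fintype.sum_prod_type, Finset.sum_mul_sum]
        _ ≤ 1 * ediam K ^ t := by gcongr
        _ = ediam K ^ t := one_mul _

/-- The dimension of the attractor of a finite system of contractions is at most the similarity
dimension. -/
theorem dimH_le_ofReal_of_subset_iUnion_image (hf : ∀ i, LipschitzWith (ρ i) (f i))
    (hKc : IsCompact K) (hK : K ⊆ ⋃ i, f i '' K) {b : ℝ≥0} (hb1 : b < 1) (hb : ∀ i, ρ i ≤ b)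
    (ht : 0 ≤ t) (hsum : ∑ i, ρ i ^ t ≤ 1) : dimH K ≤ ENNReal.ofReal t := by
  borelize X
  choose κ hκ A hKA hA hAsum using exists_iterated_cover hf hK hb ht hsum
  have hdiam : ediam K ≠ ∞ := hKc.isBounded.ediam_ne_top
  have hr : Tendsto (fun n => (b : ℝ≥0∞) ^ n * ediam K) atTop (𝓝 0) := by
    simpa using ENNReal.Tendsto.mul_const
      (ENNReal.tendsto_pow_atTop_nhds_zero_of_lt_one (by exact_mod_cast hb1)) (.inr hdiam)
  have hμ : μH[t] K ≤ ediam K ^ t :=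
    (Measure.hausdorffMeasure_le_liminf_sum t K _ hr A (.of_forall hA) (.of_forall hKA)).trans
      ((liminf_le_liminf (.of_forall hAsum)).trans_eq (liminf_const _))
  refine dimH_le_of_hausdorffMeasure_ne_top ?_
  rw [Real.coe_toNNReal t ht]
  exact ne_top_of_le_ne_top (ENNReal.rpow_ne_top_of_nonneg ht hdiam) hμ

end Attractor

section Spqr

/-- The contraction ratios of `Spqr p q r`. -/
def SpqrRatio (p q r : ℝ≥0) : Fin 6 → ℝ≥0 := ![p, r, q, r, r, r]

/-- The similarities `T i` send `K` to pairwise disjoint subsets of `K`, with ratios `ρ i ≤ b`; the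
index `e` is the only one whose piece can contain `0`, and `T e` has ratio `c`. -/
structure IsSeparatedFamily {ι : Type} (K : Set ℝ) (T : ι → ℝ → ℝ) (ρ : ι → ℝ≥0) (b c : ℝ≥0)
    (e : ι) : Prop where
  pos (i : ι) : 0 < ρ i
  le (i : ι) : ρ i ≤ b
  edist_eq (i : ι) (x y : ℝ) : edist (T i x) (T i y) = ρ i * edist x y
  mapsTo (i : ι) : MapsTo (T i) K K
  disjoint (i j : ι) : i ≠ j → Disjoint (T i '' K) (T j '' K)
  eq_of_zero_mem (i : ι) : 0 ∈ T i '' K → i = e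
  ratio_eq : ρ e = c

variable {p q r : ℝ≥0} {K : Set ℝ}

theorem edist_Spqr (i : Fin 6) (x y : ℝ) :
    edist (Spqr p q r i x) (Spqr p q r i y) = SpqrRatio p q r i * edist x y := by
  have h : dist (Spqr p q r i x) (Spqr p q r i y) = SpqrRatio p q r i * dist x y := by
    have hsub : Spqr p q r i x - Spqr p q r i y = SpqrRatio p q r i * (x - y) ∨
        Spqr p q r i x - Spqr p q r i y = SpqrRatio p q r i * (y - x) := by
      fin_cases i <;> simp [Spqr, SpqrRatio] <;>
        first
          | (left; ring1)
          | (right; ring1)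
    rcases hsub with hsub | hsub
    · rw [Real.dist_eq, hsub, abs_mul, NNReal.abs_eq, Real.dist_eq]
    · rw [Real.dist_eq, hsub, abs_mul, NNReal.abs_eq, abs_sub_comm, Real.dist_eq]
  rw [edist_dist, h, ENNReal.ofReal_mul NNReal.zero_le_coe, edist_dist, ENNReal.ofReal_coe_nnreal]

theorem IsAttractor.mapsTo (hK : IsAttractor (Spqr p q r) K) (i : Fin 6) :
    MapsTo (Spqr p q r i) K K := fun x hx => by
  rw [hK.2.2]
  exact mem_iUnion.2 ⟨i, x, hx, rfl⟩

namespace UniqueOnePointIntersection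

variable (h : UniqueOnePointIntersection p q r K)
include h

theorem zero_mem (hq : 0 < q) : (0 : ℝ) ∈ K := by
  obtain ⟨⟨x, hx, hx'⟩, -⟩ := h.1.symm.subset (mem_singleton (8 / 15 : ℝ))
  have : (q : ℝ) * x = 0 := by simpa [Spqr] using hx'
  rcases mul_eq_zero.1 this with h0 | rfl
  · exact absurd h0 (by exact_mod_cast hq.ne')
  · exact hx

theorem eq_zero_of_Spqr_eq_zero (hp : 0 < p) (hq : 0 < q) {i : Fin 6} {x : ℝ} (hx : x ∈ K)
    (hi : Spqr p q r i x = 0) : i = 0 ∧ x = 0 := by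
  have hi0 : i = 0 := by
    by_contra hne
    have hset : ({i, 0} : Set (Fin 6)) ≠ {2, 3} := fun hs => by
      have : (0 : Fin 6) ∈ ({2, 3} : Set (Fin 6)) := hs ▸ by simp
      simp at this
    have : (0 : ℝ) ∈ Spqr p q r i '' K ∩ Spqr p q r 0 '' K :=
      ⟨⟨x, hx, hi⟩, 0, h.zero_mem hq, by simp [Spqr]⟩
    rwa [h.2 i 0 hne hset] at this
  subst hi0
  refine ⟨rfl, ?_⟩
  have : (p : ℝ) * x = 0 := by simpa [Spqr] using hi
  exact (mul_eq_zero.1 this).resolve_left (by exact_mod_cast hp.ne')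

theorem eq_zero_of_Spqr_two_eq_Spqr_three (hq : 0 < q) {x y : ℝ} (hx : x ∈ K) (hy : y ∈ K)
    (hxy : Spqr p q r 2 x = Spqr p q r 3 y) : x = 0 := by
  have : Spqr p q r 2 x = 8 / 15 := h.1.subset ⟨⟨x, hx, rfl⟩, y, hy, hxy.symm⟩
  have : (q : ℝ) * x = 0 := by simpa [Spqr] using this
  exact (mul_eq_zero.1 this).resolve_left (by exact_mod_cast hq.ne')

theorem eq_or_of_Spqr_eq_Spqr {i j : Fin 6} (hij : i ≠ j) {x y : ℝ} (hx : x ∈ K) (hy : y ∈ K)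
    (hxy : Spqr p q r i x = Spqr p q r j y) : i = 2 ∧ j = 3 ∨ i = 3 ∧ j = 2 := by
  rw [← Set.pair_eq_pair_iff]
  by_contra hne
  have : Spqr p q r i x ∈ Spqr p q r i '' K ∩ Spqr p q r j '' K := ⟨⟨x, hx, rfl⟩, y, hy, hxy.symm⟩
  rwa [h.2 i j hij hne] at this

end UniqueOnePointIntersection

/-- Composing every map of a separated family with every `Spqr p q r i`, and leaving out the one
composition which touches another piece, gives a separated family again. -/
theorem IsSeparatedFamily.comp (h : UniqueOnePointIntersection p q r K)
    (hK : IsAttractor (Spqr p q r) K) (hp : 0 < p) (hq : 0 < q) (hr : 0 < r) {a : ℝ≥0}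
    (ha : ∀ i, SpqrRatio p q r i ≤ a) {ι : Type} {T : ι → ℝ → ℝ} {ρ : ι → ℝ≥0} {b c : ℝ≥0} {e : ι}
    (hT : IsSeparatedFamily K T ρ b c e) :
    IsSeparatedFamily K (fun x : {x : Fin 6 × ι // x ≠ (2, e)} => Spqr p q r x.1.1 ∘ T x.1.2)
      (fun x => SpqrRatio p q r x.1.1 * ρ x.1.2) (a * b) (p * c) ⟨(0, e), by simp⟩ where
  pos x := mul_pos (by rcases x with ⟨⟨i, _⟩, _⟩; fin_cases i <;> simpa [SpqrRatio]) (hT.pos _)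
  le x := mul_le_mul' (ha _) (hT.le _)
  edist_eq x y z := by simp [edist_Spqr, hT.edist_eq, mul_assoc]
  mapsTo x := (hK.mapsTo _).comp (hT.mapsTo _)
  disjoint := by
    rintro ⟨⟨i, k⟩, hik⟩ ⟨⟨j, l⟩, hjl⟩ hne
    rw [Set.disjoint_left]
    rintro _ ⟨x, hx, rfl⟩ ⟨y, hy, hxy⟩
    simp only [Function.comp_apply] at hxy
    by_cases hij : i = j
    · subst hij
      have hkl : k ≠ l := fun hkl => hne (by simp [hkl])
      have hinj : T l y = T k x := by
        have h0 : (SpqrRatio p q r i : ℝ≥0∞) * edist (T l y) (T k x) = 0 := by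
          rw [← edist_Spqr, hxy, edist_self]
        have hi : 0 < SpqrRatio p q r i := by fin_cases i <;> simpa [SpqrRatio]
        exact edist_eq_zero.1 ((mul_eq_zero.1 h0).resolve_left (by exact_mod_cast hi.ne'))
      exact Set.disjoint_left.1 (hT.disjoint k l hkl) ⟨x, hx, rfl⟩ ⟨y, hy, hinj⟩
    · rcases h.eq_or_of_Spqr_eq_Spqr hij (hT.mapsTo k hx) (hT.mapsTo l hy) hxy.symm with
        ⟨rfl, rfl⟩ | ⟨rfl, rfl⟩
      · have := h.eq_zero_of_Spqr_two_eq_Spqr_three hq (hT.mapsTo k hx) (hT.mapsTo l hy) hxy.symm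
        exact hik (by rw [hT.eq_of_zero_mem k ⟨x, hx, this⟩])
      · have := h.eq_zero_of_Spqr_two_eq_Spqr_three hq (hT.mapsTo l hy) (hT.mapsTo k hx) hxy
        exact hjl (by rw [hT.eq_of_zero_mem l ⟨y, hy, this⟩])
  eq_of_zero_mem := by
    rintro ⟨⟨i, k⟩, hik⟩ ⟨x, hx, hx0⟩
    obtain ⟨rfl, hx0'⟩ := h.eq_zero_of_Spqr_eq_zero hp hq (hT.mapsTo k hx) hx0
    simp [hT.eq_of_zero_mem k ⟨x, hx, hx0'⟩]
  ratio_eq := by simp [SpqrRatio, hT.ratio_eq]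

theorem exists_isSeparatedFamily (h : UniqueOnePointIntersection p q r K)
    (hK : IsAttractor (Spqr p q r) K) (hp : 0 < p) (hq : 0 < q) (hr : 0 < r) {a : ℝ≥0}
    (ha : ∀ i, SpqrRatio p q r i ≤ a) {s : ℝ} (hs : ∑ i, SpqrRatio p q r i ^ s = 1) (n : ℕ) :
    ∃ (ι : Type) (_ : Fintype ι) (T : ι → ℝ → ℝ) (ρ : ι → ℝ≥0) (e : ι),
      IsSeparatedFamily K T ρ (a ^ n) (p ^ n) e ∧
      ∑ i, ρ i ^ s + q ^ s * ∑ k ∈ Finset.range n, (p ^ s) ^ k = 1 := by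
  classical
  induction n with
  | zero =>
    refine ⟨Unit, inferInstance, fun _ x => x, fun _ => 1, (), ?_, by simp⟩
    constructor <;> simp [MapsTo]
  | succ n ih =>
    obtain ⟨ι, _, T, ρ, e, hT, hsum⟩ := ih
    have hcomp := hT.comp h hK hp hq hr ha
    rw [← pow_succ', ← pow_succ'] at hcomp
    refine ⟨_, inferInstance, _, _, _, hcomp, ?_⟩
    have htotal : ∑ x : Fin 6 × ι, (SpqrRatio p q r x.1 * ρ x.2) ^ s = ∑ i, ρ i ^ s := by
      simp_rw [NNReal.mul_rpow, Fintype.sum_prod_type]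
      rw [← Finset.sum_mul_sum, hs, one_mul]
    have hsplit := Fintype.sum_eq_add_sum_subtype_ne
      (fun x : Fin 6 × ι => (SpqrRatio p q r x.1 * ρ x.2) ^ s) (2, e)
    have h2 : (SpqrRatio p q r 2 * ρ e) ^ s = q ^ s * (p ^ s) ^ n := by
      rw [hT.ratio_eq, NNReal.mul_rpow, ← NNReal.rpow_natCast_mul, mul_comm (n : ℝ),
        NNReal.rpow_mul_natCast]
      simp [SpqrRatio]
    rw [htotal, h2] at hsplit
    rw [← hsum, hsplit, Finset.sum_range_succ]
    ring

theorem le_of_add_mul_geom_sum_eq_one {x y z w : ℝ≥0} (h : x + y + z = 1) (hx : x < 1)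
    {n : ℕ} (hw : w + y * ∑ k ∈ Finset.range n, x ^ k = 1) : z ≤ w := by
  have hgeom : (∑ k ∈ Finset.range n, (x : ℝ) ^ k) * (1 - x) = 1 - (x : ℝ) ^ n :=
    geom_sum_mul_neg _ _
  have h' : (x : ℝ) + y + z = 1 := by exact_mod_cast h
  have hw' : (w : ℝ) + y * ∑ k ∈ Finset.range n, (x : ℝ) ^ k = 1 := by exact_mod_cast hw
  have hx' : (x : ℝ) < 1 := by exact_mod_cast hx
  have hzx : (0 : ℝ) ≤ z * x := mul_nonneg z.2 x.2
  have hyx : (0 : ℝ) ≤ y * (x : ℝ) ^ n := by positivity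
  have key : (z : ℝ) * (1 - x) ≤ w * (1 - x) := by
    have : (w : ℝ) * (1 - x) = (1 - x) - y * (1 - (x : ℝ) ^ n) := by
      rw [← hgeom]; linear_combination (1 - (x : ℝ)) * hw'
    nlinarith
  exact_mod_cast le_of_mul_le_mul_right key (by linarith)

theorem ofReal_le_dimH_of_uniqueOnePointIntersection {p q r : ℝ≥0} {K : Set ℝ}
    (h : UniqueOnePointIntersection p q r K) (hK : IsAttractor (Spqr p q r) K) (hp : 0 < p)
    (hq : 0 < q) (hr : 0 < r) {a : ℝ≥0} (ha1 : a < 1) (ha : ∀ i, SpqrRatio p q r i ≤ a) {s : ℝ}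
    (hs : 0 < s) (hsum : p ^ s + q ^ s + 4 * r ^ s = 1)
    (hsum' : ∑ i, SpqrRatio p q r i ^ s = 1) {t : ℝ} (ht : 0 < t) (hts : t < s) :
    ENNReal.ofReal t ≤ dimH K := by
  have hz : 0 < 4 * r ^ s := mul_pos (by norm_num) (NNReal.rpow_pos hr)
  have hβ : a ^ (s - t) < 1 := NNReal.rpow_lt_one ha1 (sub_pos.2 hts)
  obtain ⟨n, hn, hn1⟩ := (((NNReal.tendsto_pow_atTop_nhds_zero_of_lt_one hβ).eventually_le_const
    hz).and (eventually_ge_atTop 1)).exists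
  obtain ⟨ι, _, T, ρ, e, hT, hρ⟩ := exists_isSeparatedFamily h hK hp hq hr ha hsum' n
  have hp1 : p < 1 := (ha 0).trans_lt ha1
  have hzρ : 4 * r ^ s ≤ ∑ i, ρ i ^ s :=
    le_of_add_mul_geom_sum_eq_one hsum (NNReal.rpow_lt_one hp1 hs) hρ
  have hst : ∑ i, ρ i ^ s ≤ (a ^ (s - t)) ^ n * ∑ i, ρ i ^ t := by
    rw [Finset.mul_sum]
    gcongr with i
    calc ρ i ^ s = ρ i ^ (s - t) * ρ i ^ t := by
          rw [← NNReal.rpow_add (hT.pos i).ne', sub_add_cancel]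
      _ ≤ (a ^ n) ^ (s - t) * ρ i ^ t := by
          gcongr
          · exact hT.le i
      _ = (a ^ (s - t)) ^ n * ρ i ^ t := by
          rw [← NNReal.rpow_natCast_mul, mul_comm (n : ℝ), NNReal.rpow_mul_natCast]
  have hone : 1 ≤ ∑ i, ρ i ^ t := by
    refine le_of_mul_le_mul_left (a := 4 * r ^ s) ?_ hz
    calc 4 * r ^ s * 1 ≤ (a ^ (s - t)) ^ n * ∑ i, ρ i ^ t := by
          rw [mul_one]; exact hzρ.trans hst
      _ ≤ 4 * r ^ s * ∑ i, ρ i ^ t := by gcongr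
  exact ofReal_le_dimH_of_disjoint_similar_images hT.pos
    (fun i => (hT.le i).trans_lt (pow_lt_one₀ zero_le ha1 (by omega))) hT.edist_eq hK.2.1 hK.1
    hT.mapsTo hT.disjoint ht hone

end Spqr

/-- If `S_pqr` has unique one-point intersection, then the Hausdorff dimension of its
attractor equals the similarity dimension `s`, the unique `s > 0` with
`p^s + q^s + 4·r^s = 1`. -/
theorem stmt16 (p q r : ℝ) (hp : p ∈ Ioo (0:ℝ) (1/36)) (hq : q ∈ Ioo (0:ℝ) (1/36))
    (hr : r ∈ Ioo (0:ℝ) (1/36)) (K : Set ℝ) (hK : IsAttractor (Spqr p q r) K)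
    (huopi : UniqueOnePointIntersection p q r K)
    (s : ℝ) (hs : 0 < s) (hsim : p ^ s + q ^ s + 4 * r ^ s = 1) :
    dimH K = ENNReal.ofReal s := by
  lift p to ℝ≥0 using hp.1.le
  lift q to ℝ≥0 using hq.1.le
  lift r to ℝ≥0 using hr.1.le
  have hle {x : ℝ≥0} (hx : (x : ℝ) ∈ Ioo (0 : ℝ) (1 / 36)) : x ≤ 1 / 36 := by
    exact_mod_cast hx.2.le
  have ha : ∀ i, SpqrRatio p q r i ≤ 1 / 36 := fun i => by
    fin_cases i <;> simpa [SpqrRatio] using hle (by assumption)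
  have ha1 : (1 / 36 : ℝ≥0) < 1 := by
    rw [← NNReal.coe_lt_coe]; norm_num
  have hsum : p ^ s + q ^ s + 4 * r ^ s = 1 := by exact_mod_cast hsim
  have hsum' : ∑ i, SpqrRatio p q r i ^ s = 1 := by
    simp only [Fin.sum_univ_six, SpqrRatio]
    rw [← hsum]
    simp
    ring
  apply le_antisymm
  · exact dimH_le_ofReal_of_subset_iUnion_image (fun i x y => (edist_Spqr i x y).le) hK.2.1
      hK.2.2.subset ha1 ha hs.le hsum'.le
  · refine le_of_forall_lt fun c hc => ?_
    lift c to ℝ≥0 using hc.ne_top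
    obtain ⟨t, hct, hts⟩ := exists_between
      (show (c : ℝ) < s from (ENNReal.lt_ofReal_iff_toReal_lt ENNReal.coe_ne_top).1 hc)
    have ht : 0 < t := c.2.trans_lt hct
    refine ((ENNReal.lt_ofReal_iff_toReal_lt ENNReal.coe_ne_top).2 hct).trans_le ?_
    exact ofReal_le_dimH_of_uniqueOnePointIntersection huopi hK (by exact_mod_cast hp.1)
      (by exact_mod_cast hq.1) (by exact_mod_cast hr.1) ha1 ha hs hsum hsum' ht hts
end
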